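/- arXiv:1010.4664 — 7 statements merged into one kernel-verified Lean document; each statement's English description precedes it below -/
import Mathlib

section
/- Let β ∈ ℂ and let k ≥ 1 be an integer, and set M(z) = (z − β)^k. Then for every real number α with −1 < α < 1, Π_α(M) = { ζ ↦ (Aζ + C)^k : A a real number with A > 0, C ∈ ℂ }. -/
open Filter Topology Complex

noncomputable section

/-- Locally uniform convergence on `ℂ` with respect to the spherical metric,
expressed via the Euclidean criterion: near every point, either the functions
converge uniformly to `g` in the Euclidean metric, or they are eventually
nonvanishing there and their reciprocals converge uniformly to `1/g`. -/
def SphLocUnifConv (F : ℕ → ℂ → ℂ) (g : ℂ → ℂ) : Prop :=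
  ∀ z₀ : ℂ, ∃ U ∈ 𝓝 z₀,
    TendstoUniformlyOn F g atTop U ∨
    ((∀ᶠ n in atTop, ∀ w ∈ U, F n w ≠ 0) ∧
      TendstoUniformlyOn (fun n w => (F n w)⁻¹) (fun w => (g w)⁻¹) atTop U)

/-- `Π_α(h)` : the set of all nonconstant meromorphic functions `g` on `ℂ` for which
there exist `z₀ ∈ ℂ`, naturals `k n → ∞`, complex `z n → z₀` and positive reals
`ρ n → 0` such that `ζ ↦ ρ n ^ (-α) * h (k n * z n + k n * ρ n * ζ)` converges to `g`
locally uniformly on `ℂ` in the spherical metric. -/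
def PiAlpha (α : ℝ) (h : ℂ → ℂ) : Set (ℂ → ℂ) :=
  { g | MeromorphicOn g Set.univ ∧ (∀ c : ℂ, g ≠ fun _ => c) ∧
      ∃ (z₀ : ℂ) (k : ℕ → ℕ) (z : ℕ → ℂ) (ρ : ℕ → ℝ),
        Tendsto k atTop atTop ∧
        Tendsto z atTop (𝓝 z₀) ∧
        (∀ n, 0 < ρ n) ∧ Tendsto ρ atTop (𝓝 0) ∧
        SphLocUnifConv
          (fun n ζ => ((ρ n ^ (-α) : ℝ) : ℂ) * h ((k n : ℂ) * z n + (k n : ℂ) * (ρ n : ℂ) * ζ))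
          g }

lemma SphLocUnifConv.comp_strictMono {F : ℕ → ℂ → ℂ} {g : ℂ → ℂ} (h : SphLocUnifConv F g)
    {φ : ℕ → ℕ} (hφ : StrictMono φ) : SphLocUnifConv (fun n => F (φ n)) g := by
  intro z₀
  obtain ⟨U, hU, h | ⟨h₁, h₂⟩⟩ := h z₀
  · exact ⟨U, hU, Or.inl fun u hu => hφ.tendsto_atTop.eventually (h u hu)⟩
  · exact ⟨U, hU, Or.inr ⟨hφ.tendsto_atTop.eventually h₁,
      fun u hu => hφ.tendsto_atTop.eventually (h₂ u hu)⟩⟩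

lemma SphLocUnifConv.tendsto_or_tendsto_inv {F : ℕ → ℂ → ℂ} {g : ℂ → ℂ}
    (h : SphLocUnifConv F g) (w : ℂ) :
    Tendsto (fun n => F n w) atTop (𝓝 (g w)) ∨
      Tendsto (fun n => (F n w)⁻¹) atTop (𝓝 (g w)⁻¹) := by
  obtain ⟨U, hU, h | ⟨-, h⟩⟩ := h w
  · exact Or.inl (h.tendsto_at (mem_of_mem_nhds hU))
  · exact Or.inr (h.tendsto_at (mem_of_mem_nhds hU))

lemma SphLocUnifConv.eq_of_tendsto {F : ℕ → ℂ → ℂ} {g : ℂ → ℂ} (h : SphLocUnifConv F g)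
    {w L : ℂ} (hL : Tendsto (fun n => F n w) atTop (𝓝 L)) : g w = L := by
  rcases h.tendsto_or_tendsto_inv w with h | h
  · exact tendsto_nhds_unique h hL
  · by_cases hg : g w = 0
    · by_cases hL0 : L = 0
      · rw [hg, hL0]
      · exact inv_injective (tendsto_nhds_unique h (hL.inv₀ hL0))
    · have := h.inv₀ (inv_ne_zero hg)
      simp only [inv_inv] at this
      exact tendsto_nhds_unique this hL

/-- Where the functions tend to infinity, the limit has a pole, encoded by the value `0`. -/
lemma SphLocUnifConv.eq_zero_of_tendsto_norm_atTop {F : ℕ → ℂ → ℂ} {g : ℂ → ℂ}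
    (h : SphLocUnifConv F g) {w : ℂ} (hw : Tendsto (fun n => ‖F n w‖) atTop atTop) :
    g w = 0 := by
  rcases h.tendsto_or_tendsto_inv w with h | h
  · exact absurd hw (not_tendsto_atTop_of_tendsto_nhds h.norm)
  · have h0 : Tendsto (fun n => (F n w)⁻¹) atTop (𝓝 0) :=
      tendsto_zero_iff_norm_tendsto_zero.2 (by simpa [Pi.inv_def] using hw.inv_tendsto_atTop)
    simpa using tendsto_nhds_unique h h0

/-- The coefficients of affine functions whose `k`-th powers converge spherically to a
nonconstant function cannot tend to infinity. -/
lemma SphLocUnifConv.not_tendsto_norm_coeff_atTop {a : ℕ → ℝ} {b : ℕ → ℂ} {k : ℕ} {g : ℂ → ℂ}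
    (hk : k ≠ 0) (ha : ∀ n, 0 < a n) (hg : ∀ c : ℂ, g ≠ fun _ => c)
    (h : SphLocUnifConv (fun n ζ => ((a n : ℂ) * ζ + b n) ^ k) g) :
    ¬ Tendsto (fun n => ‖(a n, b n)‖) atTop atTop := by
  intro hr
  have hmem : ∀ n, ‖(a n, b n)‖⁻¹ • (a n, b n) ∈ Metric.sphere (0 : ℝ × ℂ) 1 := fun n => by
    have hne : (a n, b n) ≠ 0 := fun h0 => (ha n).ne' (congrArg Prod.fst h0)
    rw [mem_sphere_zero_iff_norm, norm_smul, norm_inv, norm_norm,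
      inv_mul_cancel₀ (norm_ne_zero_iff.2 hne)]
  obtain ⟨⟨A, B⟩, hAB, φ, hφ, hlim⟩ := (isCompact_sphere (0 : ℝ × ℂ) 1).tendsto_subseq hmem
  replace h := h.comp_strictMono hφ
  replace hr := hr.comp hφ.tendsto_atTop
  set r : ℕ → ℝ := fun n => ‖(a (φ n), b (φ n))‖ with hrdef
  replace hr : Tendsto r atTop atTop := hr
  have hA : Tendsto (fun n => (r n)⁻¹ * a (φ n)) atTop (𝓝 A) :=
    (continuous_fst.tendsto _).comp hlim
  have hB : Tendsto (fun n => ((r n : ℂ))⁻¹ * b (φ n)) atTop (𝓝 B) := by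
    refine ((continuous_snd.tendsto _).comp hlim).congr fun n => ?_
    simp [hrdef]
  have hrpos : ∀ n, 0 < r n := fun n =>
    norm_pos_iff.2 fun h0 => (ha (φ n)).ne' (congrArg Prod.fst h0)
  have hinf : ∀ w : ℂ, (A : ℂ) * w + B ≠ 0 →
      Tendsto (fun n => ‖((a (φ n) : ℂ) * w + b (φ n)) ^ k‖) atTop atTop := by
    intro w hw
    have h1 : Tendsto (fun n => ‖(((r n)⁻¹ * a (φ n) : ℝ) : ℂ) * w + (r n : ℂ)⁻¹ * b (φ n)‖)
        atTop (𝓝 ‖(A : ℂ) * w + B‖) :=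
      ((((continuous_ofReal.tendsto _).comp hA).mul_const w).add hB).norm
    have h2 := hr.atTop_mul_pos (norm_pos_iff.2 hw) h1
    simp only [norm_pow]
    refine (tendsto_pow_atTop hk).comp (h2.congr fun n => ?_)
    have hr0 : (r n : ℂ) ≠ 0 := ofReal_ne_zero.2 (hrpos n).ne'
    nth_rewrite 1 [← abs_of_pos (hrpos n)]
    rw [← Real.norm_eq_abs, ← norm_real, ← norm_mul]
    congr 1
    push_cast
    field_simp
  by_cases hA0 : A = 0
  · have hB0 : B ≠ 0 := by
      rintro rfl
      subst hA0
      simp at hAB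
    exact hg 0 (funext fun w => h.eq_zero_of_tendsto_norm_atTop (hinf w (by simpa [hA0] using hB0)))
  · have hA0' : (A : ℂ) ≠ 0 := ofReal_ne_zero.2 hA0
    have hzero : Tendsto (fun n => -(b (φ n)) / (a (φ n) : ℂ)) atTop (𝓝 (-B / A)) := by
      refine (hB.neg.div ((continuous_ofReal.tendsto _).comp hA) hA0').congr fun n => ?_
      have hr0 : (r n : ℂ) ≠ 0 := ofReal_ne_zero.2 (hrpos n).ne'
      have ha0 : (a (φ n) : ℂ) ≠ 0 := ofReal_ne_zero.2 (ha _).ne'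
      simp only [Pi.div_apply, Function.comp_apply]
      push_cast
      field_simp
    obtain ⟨U, hU, hu | ⟨hu, -⟩⟩ := h (-B / A)
    · obtain ⟨w, hwU, hw⟩ : ∃ w ∈ U, w ≠ -B / A := by
        obtain ⟨w, hw⟩ := (NormedField.nhdsNE_neBot (-B / A : ℂ)).nonempty_of_mem
          (inter_mem (mem_nhdsWithin_of_mem_nhds hU) self_mem_nhdsWithin)
        exact ⟨w, hw.1, hw.2⟩
      refine not_tendsto_atTop_of_tendsto_nhds (hu.tendsto_at hwU).norm (hinf w fun h0 => hw ?_)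
      rw [eq_div_iff hA0']
      linear_combination h0
    · obtain ⟨n, hn, hn'⟩ := (hu.and (hzero.eventually hU)).exists
      refine hn _ hn' ?_
      have ha0 : (a (φ n) : ℂ) ≠ 0 := ofReal_ne_zero.2 (ha _).ne'
      simp only [mul_div_cancel₀ _ ha0, neg_add_cancel, zero_pow hk]

/-- A nonconstant spherical limit of `k`-th powers of affine functions with positive slopes is
again such a power. -/
lemma SphLocUnifConv.exists_eq_affine_pow {a : ℕ → ℝ} {b : ℕ → ℂ} {k : ℕ} {g : ℂ → ℂ}
    (hk : k ≠ 0) (ha : ∀ n, 0 < a n) (hg : ∀ c : ℂ, g ≠ fun _ => c)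
    (h : SphLocUnifConv (fun n ζ => ((a n : ℂ) * ζ + b n) ^ k) g) :
    ∃ (A : ℝ) (C : ℂ), 0 < A ∧ g = fun ζ => ((A : ℂ) * ζ + C) ^ k := by
  have hnot := h.not_tendsto_norm_coeff_atTop hk ha hg
  rw [tendsto_atTop] at hnot
  push Not at hnot
  obtain ⟨R, hR⟩ := hnot
  have hfreq : ∃ᶠ n in atTop, (a n, b n) ∈ Metric.closedBall (0 : ℝ × ℂ) R :=
    hR.mono fun n hn => mem_closedBall_zero_iff.2 hn.le
  obtain ⟨⟨A, C⟩, -, φ, hφ, hlim⟩ :=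
    tendsto_subseq_of_frequently_bounded Metric.isBounded_closedBall hfreq
  have hA : Tendsto (fun n => a (φ n)) atTop (𝓝 A) := (continuous_fst.tendsto _).comp hlim
  have hC : Tendsto (fun n => b (φ n)) atTop (𝓝 C) := (continuous_snd.tendsto _).comp hlim
  have hgeq : g = fun ζ => ((A : ℂ) * ζ + C) ^ k := funext fun ζ =>
    (h.comp_strictMono hφ).eq_of_tendsto
      (((((continuous_ofReal.tendsto _).comp hA).mul_const ζ).add hC).pow k)
  refine ⟨A, C, lt_of_le_of_ne (ge_of_tendsto' hA fun n => (ha _).le) ?_, hgeq⟩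
  rintro rfl
  exact hg (C ^ k) (by simpa using hgeq)

lemma affine_pow_ne_const {A C : ℂ} {k : ℕ} (hA : A ≠ 0) (hk : k ≠ 0) (c : ℂ) :
    (fun ζ : ℂ => (A * ζ + C) ^ k) ≠ fun _ => c := by
  intro h
  have h0 := congrFun h (-C / A)
  have h1 := congrFun h ((1 - C) / A)
  simp only [mul_div_cancel₀ _ hA, neg_add_cancel, zero_pow hk, sub_add_cancel, one_pow] at h0 h1
  exact zero_ne_one (h0.trans h1.symm)

/-- Absorbing the factor `ρ ^ (-α)` into the `k`-th power of an affine function. -/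
lemma rpow_neg_mul_pow {ρ : ℝ} (hρ : 0 < ρ) {k : ℕ} (hk : k ≠ 0) (α : ℝ) (w : ℂ) :
    ((ρ ^ (-α) : ℝ) : ℂ) * w ^ k = (((ρ ^ (-α / k) : ℝ) : ℂ) * w) ^ k := by
  have hk' : (k : ℝ) ≠ 0 := Nat.cast_ne_zero.2 hk
  rw [mul_pow, ← ofReal_pow, ← Real.rpow_mul_natCast hρ.le, div_mul_cancel₀ _ hk']

/-- For `M(z) = (z - β)^k` with `k ≥ 1`, for every `-1 < α < 1`,
`Π_α(M) = { ζ ↦ (Aζ + C)^k : A > 0 real, C ∈ ℂ }`. -/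
theorem piAlpha_monomial (β : ℂ) (k : ℕ) (hk : 1 ≤ k) (α : ℝ) (hα₁ : -1 < α) (hα₂ : α < 1) :
    PiAlpha α (fun z => (z - β) ^ k) =
      { g | ∃ (A : ℝ) (C : ℂ), 0 < A ∧ g = fun ζ => ((A : ℂ) * ζ + C) ^ k } := by
  have hk0 : k ≠ 0 := Nat.one_le_iff_ne_zero.1 hk
  ext g
  constructor
  · rintro ⟨-, hg, z₀, m, z, ρ, hm, -, hρ, -, hconv⟩
    obtain ⟨N, hN⟩ := eventually_atTop.1 (hm.eventually_ge_atTop 1)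
    have hshift : StrictMono fun n : ℕ => n + N := fun _ _ h => Nat.add_lt_add_right h N
    refine SphLocUnifConv.exists_eq_affine_pow
      (a := fun n => ρ (n + N) ^ (-α / k) * (m (n + N) * ρ (n + N)))
      (b := fun n => ((ρ (n + N) ^ (-α / k) : ℝ) : ℂ) * (m (n + N) * z (n + N) - β))
      hk0 (fun n => ?_) hg ?_
    · have hmpos : (0 : ℝ) < m (n + N) := Nat.cast_pos.2 (hN _ (Nat.le_add_left N n))
      exact mul_pos (Real.rpow_pos_of_pos (hρ _) _) (mul_pos hmpos (hρ _))
    · convert hconv.comp_strictMono hshift using 3 with n ζ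
      rw [rpow_neg_mul_pow (hρ _) hk0]
      push_cast
      ring
  · rintro ⟨A, C, hA, rfl⟩
    have hA' : (A : ℂ) ≠ 0 := ofReal_ne_zero.2 hA.ne'
    have hkpos : (1 : ℝ) ≤ k := by exact_mod_cast hk
    have hs : 0 < 1 - α / k := by
      rw [sub_pos, div_lt_one (by linarith)]
      linarith
    set s : ℝ := 1 - α / k with hsdef
    have hpos : ∀ n : ℕ, (0 : ℝ) < n + 1 := fun n => by positivity
    have hρpos : ∀ n : ℕ, 0 < (A / (n + 1 : ℝ)) ^ s⁻¹ := fun n =>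
      Real.rpow_pos_of_pos (div_pos hA (hpos n)) _
    have hρlim : Tendsto (fun n : ℕ => (A / (n + 1 : ℝ)) ^ s⁻¹) atTop (𝓝 0) := by
      have h1 : Tendsto (fun n : ℕ => A / (n + 1 : ℝ)) atTop (𝓝 0) :=
        tendsto_const_nhds.div_atTop (tendsto_natCast_atTop_atTop.atTop_add tendsto_const_nhds)
      simpa [Real.zero_rpow (inv_ne_zero hs.ne')] using h1.rpow_const (Or.inr (inv_pos.2 hs).le)
    refine ⟨fun z _ => ?_, affine_pow_ne_const hA' hk0, 0, fun n => n + 1,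
      fun n => β / (n + 1 : ℂ) + C * (((A / (n + 1 : ℝ)) ^ s⁻¹ : ℝ) : ℂ) / A,
      fun n => (A / (n + 1 : ℝ)) ^ s⁻¹, tendsto_add_atTop_nat 1, ?_, hρpos, hρlim, ?_⟩
    · exact AnalyticAt.meromorphicAt (by fun_prop)
    · have h1 : Tendsto (fun n : ℕ => β / (n + 1 : ℂ)) atTop (𝓝 0) := by
        simpa [div_eq_mul_inv] using
          (tendsto_one_div_add_atTop_nhds_zero_nat (𝕜 := ℂ)).const_mul β
      simpa using h1.add ((((continuous_ofReal.tendsto _).comp hρlim).const_mul C).div_const (A : ℂ))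
    · have heq : ∀ (n : ℕ) (ζ : ℂ),
          ((((A / (n + 1 : ℝ)) ^ s⁻¹) ^ (-α) : ℝ) : ℂ) *
            (((n + 1 : ℕ) : ℂ) * (β / (n + 1 : ℂ) + C * (((A / (n + 1 : ℝ)) ^ s⁻¹ : ℝ) : ℂ) / A) +
              ((n + 1 : ℕ) : ℂ) * (((A / (n + 1 : ℝ)) ^ s⁻¹ : ℝ) : ℂ) * ζ - β) ^ k =
            ((A : ℂ) * ζ + C) ^ k := by
        intro n ζ
        rw [rpow_neg_mul_pow (hρpos n) hk0]
        have hkey : ((A / (n + 1 : ℝ)) ^ s⁻¹) ^ (-α / k) * (A / (n + 1 : ℝ)) ^ s⁻¹ =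
            A / (n + 1 : ℝ) := by
          rw [← Real.rpow_add_one (hρpos n).ne', show -α / k + 1 = s by rw [hsdef]; ring,
            Real.rpow_inv_rpow (div_pos hA (hpos n)).le hs.ne']
        have hn : (n + 1 : ℂ) ≠ 0 := Nat.cast_add_one_ne_zero n
        replace hkey := congrArg (fun x : ℝ => (x : ℂ)) hkey
        simp only [ofReal_mul, ofReal_div, ofReal_add, ofReal_natCast, ofReal_one] at hkey
        rw [eq_div_iff hn] at hkey
        congr 1
        generalize (((A / (n + 1 : ℝ)) ^ s⁻¹ : ℝ) : ℂ) = x at hkey ⊢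
        generalize ((((A / (n + 1 : ℝ)) ^ s⁻¹) ^ (-α / k) : ℝ) : ℂ) = y at hkey ⊢
        push_cast
        field_simp
        linear_combination (C + A * ζ) * hkey
      intro w
      refine ⟨Set.univ, univ_mem, Or.inl ?_⟩
      simp only [heq]
      exact fun u hu => Eventually.of_forall fun _ _ _ => refl_mem_uniformity hu
end
end

section
/- Let P(z) = L·(z−γ₁)^{l₁}⋯(z−γ_m)^{l_m} be a nonconstant polynomial, where L ≠ 0, m ≥ 1, the γ_i are distinct complex numbers and each l_i ≥ 1. For each i let c_i = L·∏_{j≠i}(γ_i − γ_j)^{l_j} (the value at γ_i of P(z)/(z−γ_i)^{l_i}). Then for every real α with 0 < α < 1, Π_α(P) = { ζ ↦ c_i·(Aζ + C)^{l_i} : 1 ≤ i ≤ m, A a real number with A > 0, C ∈ ℂ }. -/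
open Filter Topology Complex

noncomputable section

/-- A spherical limit agrees with the Euclidean limit of any subsequence that has one. -/
lemma SphLocUnifConv.eq_of_tendsto_subseq {F : ℕ → ℂ → ℂ} {g : ℂ → ℂ} (h : SphLocUnifConv F g)
    {φ : ℕ → ℕ} (hφ : Tendsto φ atTop atTop) {ζ v : ℂ}
    (hv : Tendsto (fun n => F (φ n) ζ) atTop (𝓝 v)) : g ζ = v := by
  obtain ⟨U, hU, h | ⟨hne, h⟩⟩ := h ζ
  · exact tendsto_nhds_unique ((h.tendsto_at (mem_of_mem_nhds hU)).comp hφ) hv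
  · have hmul := hv.mul ((h.tendsto_at (mem_of_mem_nhds hU)).comp hφ)
    have hone : Tendsto (fun n => F (φ n) ζ * ((fun n => (F n ζ)⁻¹) ∘ φ) n) atTop (𝓝 1) := by
      refine tendsto_const_nhds.congr' ?_
      filter_upwards [hφ.eventually hne] with n hn
      exact (mul_inv_cancel₀ (hn ζ (mem_of_mem_nhds hU))).symm
    have := tendsto_nhds_unique hmul hone
    exact (eq_of_mul_inv_eq_one this).symm

/-- A nonconstant spherical limit of continuous functions is a Euclidean pointwise limit
on some nonempty open set. -/
lemma SphLocUnifConv.exists_nhds_tendsto {F : ℕ → ℂ → ℂ} {g : ℂ → ℂ} (h : SphLocUnifConv F g)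
    (hF : ∀ n, Continuous (F n)) (hg : ∀ c : ℂ, g ≠ fun _ => c) :
    ∃ ζ₀ : ℂ, ∃ U ∈ 𝓝 ζ₀, ∀ ζ ∈ U, Tendsto (fun n => F n ζ) atTop (𝓝 (g ζ)) := by
  obtain ⟨ζ₀, hζ₀⟩ : ∃ ζ₀, g ζ₀ ≠ 0 := by
    by_contra! h0
    exact hg 0 (funext h0)
  refine ⟨ζ₀, ?_⟩
  obtain ⟨U, hU, h | ⟨hne, h⟩⟩ := h ζ₀
  · exact ⟨U, hU, fun ζ hζ => h.tendsto_at hζ⟩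
  · have hcont : ContinuousOn (fun w => (g w)⁻¹) U := by
      refine h.continuousOn (Eventually.frequently ?_)
      filter_upwards [hne] with n hn
      exact (hF n).continuousOn.inv₀ hn
    have hnz : ∀ᶠ w in 𝓝 ζ₀, (g w)⁻¹ ≠ 0 :=
      (hcont.continuousAt hU).eventually_ne (inv_ne_zero hζ₀)
    refine ⟨U ∩ {w | (g w)⁻¹ ≠ 0}, inter_mem hU hnz, fun ζ hζ => ?_⟩
    simpa using (h.tendsto_at hζ.1).inv₀ hζ.2

/-- Affine maps `ζ ↦ a n + b n * ζ` that are bounded at two distinct points have a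
convergent subsequence. -/
lemma exists_subseq_tendsto_affine {a : ℕ → ℂ} {b : ℕ → ℝ} {ζ₁ ζ₂ : ℂ} (hζ : ζ₁ ≠ ζ₂)
    {R₁ R₂ : ℝ} (h₁ : ∀ᶠ n in atTop, ‖a n + b n * ζ₁‖ ≤ R₁)
    (h₂ : ∀ᶠ n in atTop, ‖a n + b n * ζ₂‖ ≤ R₂) :
    ∃ (a₀ : ℂ) (b₀ : ℝ) (φ : ℕ → ℕ), StrictMono φ ∧
      Tendsto (fun n => a (φ n)) atTop (𝓝 a₀) ∧ Tendsto (fun n => b (φ n)) atTop (𝓝 b₀) := by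
  set B := (R₁ + R₂) / ‖ζ₁ - ζ₂‖ with hB
  have hmem : ∀ᶠ n in atTop, (a n, b n) ∈
      Metric.closedBall (0 : ℂ) (R₁ + B * ‖ζ₁‖) ×ˢ Metric.closedBall (0 : ℝ) B := by
    filter_upwards [h₁, h₂] with n hn₁ hn₂
    have hb : ‖b n‖ ≤ B := by
      rw [hB, le_div_iff₀ (norm_pos_iff.2 (sub_ne_zero.2 hζ)), ← Complex.norm_real, ← norm_mul]
      calc ‖(b n : ℂ) * (ζ₁ - ζ₂)‖ = ‖(a n + b n * ζ₁) - (a n + b n * ζ₂)‖ := by ring_nf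
        _ ≤ R₁ + R₂ := (norm_sub_le _ _).trans (add_le_add hn₁ hn₂)
    refine ⟨?_, by simpa using hb⟩
    rw [mem_closedBall_zero_iff]
    calc ‖a n‖ = ‖(a n + b n * ζ₁) - b n * ζ₁‖ := by ring_nf
      _ ≤ R₁ + B * ‖ζ₁‖ := by
        refine (norm_sub_le _ _).trans (add_le_add hn₁ ?_)
        rw [norm_mul, Complex.norm_real]
        gcongr
  obtain ⟨p, -, φ, hφ, hp⟩ := tendsto_subseq_of_frequently_bounded
    (Metric.isBounded_closedBall.prod Metric.isBounded_closedBall) hmem.frequently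
  exact ⟨p.1, p.2, φ, hφ, (continuous_fst.tendsto p).comp hp, (continuous_snd.tendsto p).comp hp⟩

/-- Points where a factored polynomial is smaller than its leading coefficient are bounded. -/
lemma exists_norm_le_of_norm_prod_lt {ι : Type*} [Fintype ι] (L : ℂ) (γ : ι → ℂ) (l : ι → ℕ) :
    ∃ R : ℝ, ∀ w : ℂ, ‖L * ∏ i, (w - γ i) ^ l i‖ < ‖L‖ → ‖w‖ ≤ R := by
  refine ⟨1 + ∑ i, ‖γ i‖, fun w hw => ?_⟩
  contrapose! hw
  rw [norm_mul, norm_prod]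
  refine le_mul_of_one_le_right (norm_nonneg _) (Finset.one_le_prod fun i _ => ?_)
  rw [norm_pow]
  refine one_le_pow₀ ?_
  have h₁ : ‖γ i‖ ≤ ∑ i, ‖γ i‖ :=
    Finset.single_le_sum (f := fun i => ‖γ i‖) (fun _ _ => norm_nonneg _) (Finset.mem_univ i)
  have h₂ := norm_sub_norm_le w (γ i)
  linarith

/-- Splitting off the factor belonging to the root `γ i`. -/
lemma mul_prod_eq_pow_mul_cofactor {ι : Type*} [Fintype ι] [DecidableEq ι] (L : ℂ) (γ : ι → ℂ)
    (l : ι → ℕ) (i : ι) (w : ℂ) :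
    L * ∏ j, (w - γ j) ^ l j =
      (w - γ i) ^ l i * (L * ∏ j ∈ Finset.univ.erase i, (w - γ j) ^ l j) := by
  rw [← Finset.mul_prod_erase _ _ (Finset.mem_univ i)]
  ring

lemma cofactor_ne_zero {ι : Type*} [Fintype ι] [DecidableEq ι] {L : ℂ} (hL : L ≠ 0) {γ : ι → ℂ}
    (hγ : Function.Injective γ) (l : ι → ℕ) (i : ι) :
    L * ∏ j ∈ Finset.univ.erase i, (γ i - γ j) ^ l j ≠ 0 := by
  refine mul_ne_zero hL (Finset.prod_ne_zero_iff.2 fun j hj => pow_ne_zero _ (sub_ne_zero.2 ?_))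
  exact fun h => Finset.ne_of_mem_erase hj (hγ h).symm

lemma rpow_neg_div_pow {ρ : ℝ} (hρ : 0 < ρ) (α : ℝ) {l : ℕ} (hl : 1 ≤ l) :
    (ρ ^ (-α / l)) ^ l = ρ ^ (-α) := by
  have : (l : ℝ) ≠ 0 := by positivity
  rw [← Real.rpow_natCast, ← Real.rpow_mul hρ.le, div_mul_cancel₀ _ this]

lemma norm_le_max_of_norm_pow_le {z : ℂ} {l : ℕ} (hl : 1 ≤ l) {M : ℝ} (h : ‖z ^ l‖ ≤ M) :
    ‖z‖ ≤ max 1 M := by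
  rcases le_total ‖z‖ 1 with hz | hz
  · exact hz.trans (le_max_left _ _)
  · rw [norm_pow] at h
    exact ((le_self_pow₀ hz (by omega)).trans h).trans (le_max_right _ _)

/-- If the values of a factored polynomial along affine maps `ζ ↦ a n + b n * ζ` tend to zero on
an open set, then a subsequence of these maps contracts to one of the roots. -/
lemma exists_subseq_tendsto_root {ι : Type*} [Fintype ι] {L : ℂ} (hL : L ≠ 0) (γ : ι → ℂ)
    (l : ι → ℕ) {a : ℕ → ℂ} {b : ℕ → ℝ} {ζ₀ : ℂ} {U : Set ℂ} (hU : U ∈ 𝓝 ζ₀)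
    (h : ∀ ζ ∈ U, Tendsto (fun n => L * ∏ i, (a n + b n * ζ - γ i) ^ l i) atTop (𝓝 0)) :
    ∃ (i : ι) (φ : ℕ → ℕ), StrictMono φ ∧ Tendsto (fun n => a (φ n)) atTop (𝓝 (γ i)) ∧
      Tendsto (fun n => b (φ n)) atTop (𝓝 0) := by
  have hinf := infinite_of_mem_nhds ζ₀ hU
  obtain ⟨ζ₁, h₁, ζ₂, h₂, hne⟩ := hinf.nontrivial
  obtain ⟨R, hR⟩ := exists_norm_le_of_norm_prod_lt L γ l
  have hbdd : ∀ ζ ∈ U, ∀ᶠ n in atTop, ‖a n + b n * ζ‖ ≤ R := fun ζ hζ => by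
    have hlim := (h ζ hζ).norm
    rw [norm_zero] at hlim
    exact (hlim.eventually_lt_const (norm_pos_iff.2 hL)).mono fun n => hR _
  obtain ⟨a₀, b₀, φ, hφ, ha, hb⟩ := exists_subseq_tendsto_affine hne (hbdd _ h₁) (hbdd _ h₂)
  have hroot : ∀ ζ ∈ U, ∃ i, a₀ + b₀ * ζ = γ i := fun ζ hζ => by
    have hcont : Continuous fun w : ℂ => L * ∏ i, (w - γ i) ^ l i := by fun_prop
    have hw : Tendsto (fun n => a (φ n) + b (φ n) * ζ) atTop (𝓝 (a₀ + b₀ * ζ)) :=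
      ha.add (((Complex.continuous_ofReal.tendsto _).comp hb).mul_const ζ)
    have hzero := tendsto_nhds_unique ((hcont.tendsto _).comp hw)
      ((h ζ hζ).comp hφ.tendsto_atTop)
    obtain ⟨i, -, hi⟩ := Finset.prod_eq_zero_iff.1 ((mul_eq_zero.1 hzero).resolve_left hL)
    exact ⟨i, sub_eq_zero.1 (eq_zero_of_pow_eq_zero hi)⟩
  have hb₀ : b₀ = 0 := by
    by_contra hb₀
    refine hinf.image (f := fun ζ : ℂ => a₀ + b₀ * ζ) ?_
      ((Set.finite_range γ).subset ?_)
    · intro x _ y _ hxy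
      simpa [hb₀] using hxy
    · rintro _ ⟨ζ, hζ, rfl⟩
      obtain ⟨i, hi⟩ := hroot ζ hζ
      exact ⟨i, hi.symm⟩
  obtain ⟨i, hi⟩ := hroot ζ₁ h₁
  refine ⟨i, φ, hφ, ?_, hb₀ ▸ hb⟩
  rwa [← hi, hb₀, ofReal_zero, zero_mul, add_zero]

/-- The model functions `ζ ↦ c * (A * ζ + C) ^ l` are the only candidates for rescaling limits of
a factored polynomial. -/
lemma exists_eq_of_sphLocUnifConv {ι : Type*} [Fintype ι] [DecidableEq ι] {L : ℂ} (hL : L ≠ 0)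
    {γ : ι → ℂ} (hγ : Function.Injective γ) {l : ι → ℕ} (hl : ∀ i, 1 ≤ l i) {α : ℝ} (hα : 0 < α)
    {g : ℂ → ℂ} (hg : ∀ c : ℂ, g ≠ fun _ => c) {a : ℕ → ℂ} {b ρ : ℕ → ℝ} (hb : ∀ n, 0 ≤ b n)
    (hρ : ∀ n, 0 < ρ n) (hρ₀ : Tendsto ρ atTop (𝓝 0))
    (h : SphLocUnifConv
      (fun n ζ => ((ρ n ^ (-α) : ℝ) : ℂ) * (L * ∏ i, (a n + b n * ζ - γ i) ^ l i)) g) :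
    ∃ (i : ι) (A : ℝ) (C : ℂ), 0 < A ∧ g = fun ζ =>
      (L * ∏ j ∈ Finset.univ.erase i, (γ i - γ j) ^ l j) * ((A : ℂ) * ζ + C) ^ l i := by
  obtain ⟨ζ₀, U, hU, hlim⟩ := h.exists_nhds_tendsto (fun n => by fun_prop) hg
  have hρα : Tendsto (fun n => ((ρ n ^ α : ℝ) : ℂ)) atTop (𝓝 0) := by
    have := (Real.continuousAt_rpow_const 0 α (Or.inr hα.le)).tendsto.comp hρ₀
    rw [Real.zero_rpow hα.ne'] at this
    exact_mod_cast (Complex.continuous_ofReal.tendsto 0).comp this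
  obtain ⟨i, φ, hφ, ha, hb₀⟩ := exists_subseq_tendsto_root hL γ l (a := a) (b := b) hU
    fun ζ hζ => by
      have := hρα.mul (hlim ζ hζ)
      rw [zero_mul] at this
      refine this.congr fun n => ?_
      rw [← mul_assoc, ← ofReal_mul, ← Real.rpow_add (hρ n), add_neg_cancel, Real.rpow_zero,
        ofReal_one, one_mul]
  set c := L * ∏ j ∈ Finset.univ.erase i, (γ i - γ j) ^ l j with hc
  have hc₀ : c ≠ 0 := cofactor_ne_zero hL hγ l i
  let s : ℕ → ℝ := fun n => ρ (φ n) ^ (-α / l i)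
  have hs : ∀ n, 0 < s n := fun n => Real.rpow_pos_of_pos (hρ _) _
  let Q : ℂ → ℂ := fun w => L * ∏ j ∈ Finset.univ.erase i, (w - γ j) ^ l j
  have hQcont : Continuous Q := by fun_prop
  have hQ : ∀ ζ, Tendsto (fun n => Q (a (φ n) + b (φ n) * ζ)) atTop (𝓝 c) := fun ζ => by
    have hw := ha.add (((Complex.continuous_ofReal.tendsto _).comp hb₀).mul_const ζ)
    rw [ofReal_zero, zero_mul, add_zero] at hw
    exact (hQcont.tendsto (γ i)).comp hw
  have hF : ∀ ζ n, ((ρ (φ n) ^ (-α) : ℝ) : ℂ) *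
      (L * ∏ j, (a (φ n) + b (φ n) * ζ - γ j) ^ l j) =
      (s n * (a (φ n) - γ i) + (s n * b (φ n) : ℝ) * ζ) ^ l i *
        Q (a (φ n) + b (φ n) * ζ) := fun ζ n => by
    rw [mul_prod_eq_pow_mul_cofactor L γ l i, ← rpow_neg_div_pow (hρ _) α (hl i), ← mul_assoc,
      ofReal_pow, ← mul_pow, ofReal_mul]
    ring
  have hbdd : ∀ ζ ∈ U, ∃ R, ∀ᶠ n in atTop,
      ‖(s n * (a (φ n) - γ i) + (s n * b (φ n) : ℝ) * ζ : ℂ)‖ ≤ R := fun ζ hζ => by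
    have hdiv := (((hlim ζ hζ).comp hφ.tendsto_atTop).div (hQ ζ) hc₀).norm
    refine ⟨max 1 (‖g ζ / c‖ + 1), ?_⟩
    filter_upwards [hdiv.eventually_le_const (lt_add_one _), (hQ ζ).eventually_ne hc₀] with n hn hne
    refine norm_le_max_of_norm_pow_le (hl i) ?_
    simp only [Pi.div_apply, Function.comp_apply, hF] at hn
    rwa [mul_div_cancel_right₀ _ hne] at hn
  obtain ⟨ζ₁, h₁, ζ₂, h₂, hne⟩ := (infinite_of_mem_nhds ζ₀ hU).nontrivial
  obtain ⟨R₁, hR₁⟩ := hbdd ζ₁ h₁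
  obtain ⟨R₂, hR₂⟩ := hbdd ζ₂ h₂
  obtain ⟨C, A, ψ, hψ, hC, hA⟩ := exists_subseq_tendsto_affine
    (a := fun n => s n * (a (φ n) - γ i)) (b := fun n => s n * b (φ n)) hne hR₁ hR₂
  have hgeq : g = fun ζ => c * ((A : ℂ) * ζ + C) ^ l i := by
    funext ζ
    refine h.eq_of_tendsto_subseq (hφ.comp hψ).tendsto_atTop ?_
    have hw := hC.add (((Complex.continuous_ofReal.tendsto _).comp hA).mul_const ζ)
    have := (hw.pow (l i)).mul ((hQ ζ).comp hψ.tendsto_atTop)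
    rw [mul_comm c, add_comm (_ * ζ)]
    exact this.congr fun n => (hF ζ (ψ n)).symm
  refine ⟨i, A, C, lt_of_le_of_ne ?_ ?_, hgeq⟩
  · exact ge_of_tendsto' hA fun n => mul_nonneg (hs _).le (hb _)
  · rintro rfl
    refine hg (c * C ^ l i) (hgeq.trans ?_)
    simp

/-- Joint continuity gives spherical locally uniform convergence along a convergent parameter. -/
lemma sphLocUnifConv_of_continuous {H : ℂ → ℂ → ℂ} (hH : Continuous (Function.uncurry H))
    {t : ℕ → ℂ} {t₀ : ℂ} (ht : Tendsto t atTop (𝓝 t₀)) :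
    SphLocUnifConv (fun n => H (t n)) (H t₀) := by
  intro z₀
  let f : C(ℂ, C(ℂ, ℂ)) := ContinuousMap.curry ⟨Function.uncurry H, hH⟩
  have hf : Tendsto (fun n => f (t n)) atTop (𝓝 (f t₀)) := (f.continuous.tendsto t₀).comp ht
  refine ⟨Metric.closedBall z₀ 1, Metric.closedBall_mem_nhds _ one_pos, Or.inl ?_⟩
  exact ContinuousMap.tendsto_iff_forall_isCompact_tendstoUniformlyOn.1 hf _
    (isCompact_closedBall z₀ 1)

/-- Every model function `ζ ↦ c * (A * ζ + C) ^ l` attached to a root is a rescaling limit. -/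
lemma mem_piAlpha_of_pos {ι : Type*} [Fintype ι] [DecidableEq ι] {L : ℂ} (hL : L ≠ 0)
    {γ : ι → ℂ} (hγ : Function.Injective γ) {l : ι → ℕ} (hl : ∀ i, 1 ≤ l i) {α : ℝ} (hα₁ : 0 < α)
    (hα₂ : α < 1) (i : ι) {A : ℝ} (hA : 0 < A) (C : ℂ) :
    (fun ζ => (L * ∏ j ∈ Finset.univ.erase i, (γ i - γ j) ^ l j) * ((A : ℂ) * ζ + C) ^ l i) ∈
      PiAlpha α (fun z => L * ∏ i, (z - γ i) ^ l i) := by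
  have hc₀ := cofactor_ne_zero hL hγ l i
  have hA₀ : (A : ℂ) ≠ 0 := ofReal_ne_zero.2 hA.ne'
  have hl₀ : (1 : ℝ) ≤ l i := by exact_mod_cast hl i
  set β : ℝ := α / l i with hβ
  have hβ₀ : 0 < β := by positivity
  have hβ₁ : 0 < 1 - β := sub_pos.2 ((div_le_self hα₁.le hl₀).trans_lt hα₂)
  refine ⟨?_, fun c hc => ?_, ?_⟩
  · intro z _
    exact AnalyticAt.meromorphicAt (by fun_prop)
  · have hzero := congrFun hc (-C / A)
    have hone := congrFun hc ((1 - C) / A)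
    simp only [mul_div_cancel₀ _ hA₀, neg_add_cancel, sub_add_cancel, one_pow, mul_one,
      zero_pow (Nat.one_le_iff_ne_zero.1 (hl i)), mul_zero] at hzero hone
    exact hc₀ (hone.trans hzero.symm)
  let ρ : ℕ → ℝ := fun n => (A / (n + 1)) ^ (1 - β)⁻¹
  have hbase : ∀ n : ℕ, 0 < A / ((n : ℝ) + 1) := fun n => by positivity
  have hρ : ∀ n, 0 < ρ n := fun n => Real.rpow_pos_of_pos (hbase n) _
  have hρ₀ : Tendsto ρ atTop (𝓝 0) := by
    have hlim : Tendsto (fun n : ℕ => A / ((n : ℝ) + 1)) atTop (𝓝 0) := by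
      simpa [div_eq_mul_inv] using (tendsto_one_div_add_atTop_nhds_zero_nat (𝕜 := ℝ)).const_mul A
    have := (Real.continuousAt_rpow_const 0 (1 - β)⁻¹
      (Or.inr (inv_pos.2 hβ₁).le)).tendsto.comp hlim
    rwa [Real.zero_rpow (inv_pos.2 hβ₁).ne'] at this
  let t : ℕ → ℂ := fun n => ((ρ n ^ β : ℝ) : ℂ)
  have ht : Tendsto t atTop (𝓝 0) := by
    have := (Real.continuousAt_rpow_const 0 β (Or.inr hβ₀.le)).tendsto.comp hρ₀
    rw [Real.zero_rpow hβ₀.ne'] at this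
    exact_mod_cast (Complex.continuous_ofReal.tendsto 0).comp this
  have hscale : ∀ n : ℕ, ((n : ℂ) + 1) * (ρ n : ℂ) = t n * A := fun n => by
    have hpow : ρ n ^ (1 - β) = A / (n + 1) := Real.rpow_inv_rpow (hbase n).le hβ₁.ne'
    have hsplit : ρ n = ρ n ^ β * ρ n ^ (1 - β) := by
      rw [← Real.rpow_add (hρ n), add_sub_cancel, Real.rpow_one]
    have : ((n : ℝ) + 1) * ρ n = ρ n ^ β * A := by
      calc ((n : ℝ) + 1) * ρ n = (n + 1) * (ρ n ^ β * (A / (n + 1))) := by rw [← hpow, ← hsplit]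
        _ = ρ n ^ β * A := by field_simp
    simpa [t] using congrArg ((↑) : ℝ → ℂ) this
  refine ⟨0, fun n => n + 1, fun n => (γ i + t n * C) / ((n : ℂ) + 1), ρ,
    tendsto_add_atTop_nat 1, ?_, hρ, hρ₀, ?_⟩
  · have hinv : Tendsto (fun n : ℕ => ((n : ℂ) + 1)⁻¹) atTop (𝓝 0) := by
      simpa using tendsto_one_div_add_atTop_nhds_zero_nat (𝕜 := ℂ)
    simpa [div_eq_mul_inv] using ((ht.mul_const C).const_add (γ i)).mul hinv
  · let H : ℂ → ℂ → ℂ := fun u ζ =>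
      (L * ∏ j ∈ Finset.univ.erase i, (γ i + u * (A * ζ + C) - γ j) ^ l j) * (A * ζ + C) ^ l i
    have hH : Continuous (Function.uncurry H) := by
      simp only [H, Function.uncurry_def]
      fun_prop
    convert sphLocUnifConv_of_continuous hH ht using 3 with n ζ
    · have hn : ((n : ℂ) + 1) ≠ 0 := by exact_mod_cast n.succ_ne_zero
      have hw : ((n + 1 : ℕ) : ℂ) * ((γ i + t n * C) / ((n : ℂ) + 1)) +
          ((n + 1 : ℕ) : ℂ) * (ρ n : ℂ) * ζ = γ i + t n * (A * ζ + C) := by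
        push_cast
        rw [mul_div_cancel₀ _ hn, hscale]
        ring
      have hunit : ((ρ n ^ (-α) : ℝ) : ℂ) * t n ^ l i = 1 := by
        have hpow : (ρ n ^ β) ^ l i = ρ n ^ α := by
          simpa [hβ] using rpow_neg_div_pow (hρ n) (-α) (hl i)
        rw [← ofReal_pow, ← ofReal_mul, hpow, ← Real.rpow_add (hρ n), neg_add_cancel,
          Real.rpow_zero, ofReal_one]
      simp only [hw]
      rw [mul_prod_eq_pow_mul_cofactor L γ l i, add_sub_cancel_left, mul_pow, mul_assoc (t n ^ l i),
        ← mul_assoc, hunit, one_mul, mul_comm]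
    · simp

/-- For `P(z) = L·∏ (z - γ i)^(l i)` with `L ≠ 0`, `m ≥ 1`, distinct `γ i`
and `l i ≥ 1`, and `c i = L·∏_{j ≠ i} (γ i - γ j)^(l j)`, for every `0 < α < 1`,
`Π_α(P) = { ζ ↦ c i·(Aζ + C)^(l i) : 1 ≤ i ≤ m, A > 0 real, C ∈ ℂ }`. -/
theorem piAlpha_polynomial_pos (m : ℕ) (hm : 1 ≤ m) (L : ℂ) (hL : L ≠ 0)
    (γ : Fin m → ℂ) (hγ : Function.Injective γ) (l : Fin m → ℕ) (hl : ∀ i, 1 ≤ l i)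
    (α : ℝ) (hα₁ : 0 < α) (hα₂ : α < 1) :
    PiAlpha α (fun z => L * ∏ i, (z - γ i) ^ l i) =
      { g | ∃ (i : Fin m) (A : ℝ) (C : ℂ), 0 < A ∧
          g = fun ζ =>
            (L * ∏ j ∈ Finset.univ.erase i, (γ i - γ j) ^ l j) * ((A : ℂ) * ζ + C) ^ l i } := by
  ext g
  constructor
  · rintro ⟨-, hg, -, k, z, ρ, -, -, hρ, hρ₀, h⟩
    refine exists_eq_of_sphLocUnifConv hL hγ hl hα₁ hg (a := fun n => k n * z n)
      (b := fun n => k n * ρ n) (fun n => mul_nonneg (Nat.cast_nonneg _) (hρ n).le) hρ hρ₀ ?_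
    simpa only [ofReal_mul, ofReal_natCast] using h
  · rintro ⟨i, A, C, hA, rfl⟩
    exact mem_piAlpha_of_pos hL hγ hl hα₁ hα₂ i hA C
end
end

section
/- Let R be a nonconstant rational function having at least one zero in ℂ, with distinct zeros γ₁,…,γ_m of multiplicities l₁,…,l_m. For each i set R̃_{γ_i}(z) = R(z)/(z−γ_i)^{l_i}, so R̃_{γ_i}(γ_i) is a nonzero complex number. Then for every real α with 0 < α < 1, Π_α(R) = { ζ ↦ R̃_{γ_i}(γ_i)·(Aζ + C)^{l_i} : 1 ≤ i ≤ m, A a real number with A > 0, C ∈ ℂ }. -/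
open Filter Topology Complex

noncomputable section

/-- Along an ultrafilter, a sequence in a proper space converges or escapes to infinity. -/
theorem Ultrafilter.tendsto_cobounded_or_exists_tendsto_nhds {ι E : Type*} [PseudoMetricSpace E]
    [ProperSpace E] (u : Ultrafilter ι) (f : ι → E) :
    Tendsto f u (Bornology.cobounded E) ∨ ∃ x, Tendsto f u (𝓝 x) := by
  by_contra! h
  obtain ⟨h₁, h₂⟩ := h
  rw [Metric.cobounded_eq_cocompact, tendsto_def] at h₁
  push Not at h₁
  obtain ⟨S, hS, hfS⟩ := h₁
  obtain ⟨K, hK, hKS⟩ := mem_cocompact.1 hS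
  have hmem : f ⁻¹' K ∈ u := by
    have := Ultrafilter.compl_mem_iff_notMem.2 hfS
    refine mem_of_superset this fun n hn => ?_
    by_contra hnK
    exact hn (hKS hnK)
  obtain ⟨x, -, hx⟩ := hK.ultrafilter_le_nhds (u.map f) (le_principal_iff.2 hmem)
  exact h₂ x hx

/-- Along an ultrafilter, a nonnegative real sequence tends to `∞` or to some `v ≥ 0`. -/
theorem Ultrafilter.tendsto_atTop_or_exists_tendsto_nhds {ι : Type*} (u : Ultrafilter ι)
    {c : ι → ℝ} (hc : ∀ᶠ n in (u : Filter ι), 0 ≤ c n) :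
    Tendsto c u atTop ∨ ∃ v, 0 ≤ v ∧ Tendsto c u (𝓝 v) := by
  rcases u.tendsto_cobounded_or_exists_tendsto_nhds c with h | ⟨v, hv⟩
  · left
    refine (tendsto_norm_cobounded_atTop.comp h).congr' ?_
    filter_upwards [hc] with n hn
    simp [abs_of_nonneg hn]
  · exact Or.inr ⟨v, ge_of_tendsto hv hc, hv⟩

namespace SphLocUnifConv

variable {F : ℕ → ℂ → ℂ} {g : ℂ → ℂ} {u : Filter ℕ}

theorem tendsto_or_tendsto_inv_s4 (h : SphLocUnifConv F g) (hu : u ≤ atTop) (ζ : ℂ) :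
    Tendsto (fun n => F n ζ) u (𝓝 (g ζ)) ∨
      ((∀ᶠ n in u, F n ζ ≠ 0) ∧ Tendsto (fun n => (F n ζ)⁻¹) u (𝓝 (g ζ)⁻¹)) := by
  obtain ⟨U, hU, h₁ | ⟨h₁, h₂⟩⟩ := h ζ
  · exact Or.inl ((h₁.tendsto_at (mem_of_mem_nhds hU)).mono_left hu)
  · refine Or.inr ⟨?_, (h₂.tendsto_at (mem_of_mem_nhds hU)).mono_left hu⟩
    exact (h₁.filter_mono hu).mono fun n hn => hn ζ (mem_of_mem_nhds hU)

/-- A finite pointwise limit of the sequence is the value of the spherical limit. -/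
theorem eq_of_tendsto_s4 [u.NeBot] (h : SphLocUnifConv F g) (hu : u ≤ atTop) {ζ v : ℂ}
    (hv : Tendsto (fun n => F n ζ) u (𝓝 v)) : g ζ = v := by
  rcases h.tendsto_or_tendsto_inv_s4 hu ζ with h₁ | ⟨h₀, h₁⟩
  · exact tendsto_nhds_unique h₁ hv
  · by_cases hv0 : v = 0
    · subst hv0
      have h₂ := hv.mul h₁
      have h₃ : Tendsto (fun n => F n ζ * (F n ζ)⁻¹) u (𝓝 1) :=
        tendsto_const_nhds.congr' (by
          filter_upwards [h₀] with n hn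
          rw [mul_inv_cancel₀ hn])
      have := tendsto_nhds_unique h₂ h₃
      simp at this
    · exact inv_injective (tendsto_nhds_unique h₁ (hv.inv₀ hv0))

/-- Near a limit of zeros the convergence is uniform in the Euclidean metric. -/
theorem exists_tendstoUniformlyOn [u.NeBot] (h : SphLocUnifConv F g) (hu : u ≤ atTop)
    {q : ℕ → ℂ} {w : ℂ} (hq : Tendsto q u (𝓝 w)) (h0 : ∀ᶠ n in u, F n (q n) = 0) :
    ∃ U ∈ 𝓝 w, TendstoUniformlyOn F g u U := by
  obtain ⟨U, hU, h₁ | ⟨h₁, -⟩⟩ := h w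
  · exact ⟨U, hU, fun V hV => (h₁ V hV).filter_mono hu⟩
  · obtain ⟨n, hn₁, hn₂, hn₃⟩ := ((h₁.filter_mono hu).and (h0.and (hq hU))).exists
    exact absurd hn₂ (hn₁ _ hn₃)

/-- If the ratios `F n ζ / F n 0` tend to `1` then the spherical limit is constant. -/
theorem eq_const_of_tendsto_div [u.NeBot] (h : SphLocUnifConv F g) (hu : u ≤ atTop)
    (hF : ∀ ζ, Tendsto (fun n => F n ζ / F n 0) u (𝓝 1)) : g = fun _ => g 0 := by
  funext ζ
  have hne : ∀ᶠ n in u, F n 0 ≠ 0 := by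
    filter_upwards [(hF 0).eventually_ne one_ne_zero] with n hn h0
    simp [h0] at hn
  have key : Tendsto (fun n => F n 0) u (𝓝 (g 0)) → g ζ = g 0 := by
    intro h₀
    refine h.eq_of_tendsto_s4 hu ?_
    have := (hF ζ).mul h₀
    rw [one_mul] at this
    refine this.congr' ?_
    filter_upwards [hne] with n hn
    field_simp
  rcases h.tendsto_or_tendsto_inv_s4 hu 0 with h₁ | ⟨-, h₁⟩
  · exact key h₁
  · by_cases hg : g 0 = 0
    · have h₂ : Tendsto (fun n => (F n ζ)⁻¹) u (𝓝 0) := by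
        have := ((hF ζ).inv₀ one_ne_zero).mul h₁
        rw [hg, inv_zero, mul_zero] at this
        refine this.congr' ?_
        filter_upwards [hne] with n hn
        field_simp
      rcases h.tendsto_or_tendsto_inv_s4 hu ζ with h₃ | ⟨-, h₃⟩
      · have h₄ := h₃.mul h₂
        have h₅ : Tendsto (fun n => F n ζ * (F n ζ)⁻¹) u (𝓝 1) := by
          refine tendsto_const_nhds.congr' ?_
          filter_upwards [(hF ζ).eventually_ne one_ne_zero] with n hn
          rw [mul_inv_cancel₀]
          rintro h0
          simp [h0] at hn
        have := tendsto_nhds_unique h₄ h₅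
        simp at this
      · rw [hg]
        exact inv_eq_zero.1 (tendsto_nhds_unique h₃ h₂)
    · exact key (by simpa using h₁.inv₀ (inv_ne_zero hg))

/-- Near a limit of zeros the sequence cannot tend to `∞` at points arbitrarily close by. -/
theorem not_frequently_tendsto_atTop [u.NeBot] (h : SphLocUnifConv F g) (hu : u ≤ atTop)
    {q : ℕ → ℂ} {w : ℂ} (hq : Tendsto q u (𝓝 w)) (h0 : ∀ᶠ n in u, F n (q n) = 0) :
    ¬ ∃ᶠ ζ in 𝓝 w, Tendsto (fun n => ‖F n ζ‖) u atTop := by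
  intro hfr
  obtain ⟨U, hU, hUg⟩ := h.exists_tendstoUniformlyOn hu hq h0
  obtain ⟨ζ, hζ, hζU⟩ := (hfr.and_eventually hU).exists
  exact not_tendsto_nhds_of_tendsto_atTop hζ _ (hUg.tendsto_at hζU).norm

end SphLocUnifConv

section ZPowProd

variable {ι : Type*}

theorem prod_zpow_eq_zpow_sum (s : Finset ι) (N : ι → ℤ) {a : ℂ} (ha : a ≠ 0) :
    ∏ x ∈ s, a ^ N x = a ^ ∑ x ∈ s, N x := by
  induction s using Finset.cons_induction with
  | empty => simp
  | cons x s hx ih => rw [Finset.prod_cons, Finset.sum_cons, zpow_add₀ ha, ih]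

theorem tendsto_prod_zpow {κ : Type*} {f : Filter κ} {s : Finset ι} {b : ι → κ → ℂ} {c : ι → ℂ}
    (N : ι → ℤ) (hb : ∀ x ∈ s, Tendsto (b x) f (𝓝 (c x))) (hc : ∀ x ∈ s, c x ≠ 0) :
    Tendsto (fun n => ∏ x ∈ s, b x n ^ N x) f (𝓝 (∏ x ∈ s, c x ^ N x)) :=
  tendsto_finsetProd _ fun x hx => (hb x hx).zpow₀ _ (Or.inl (hc x hx))

theorem tendsto_norm_mul_atTop {κ : Type*} {f : Filter κ} {c : κ → ℝ} {G : κ → ℂ} {K : ℂ}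
    (hc : Tendsto c f atTop) (hG : Tendsto G f (𝓝 K)) (hK : K ≠ 0) :
    Tendsto (fun n => ‖(c n : ℂ) * G n‖) f atTop := by
  refine ((tendsto_norm_atTop_atTop.comp hc).atTop_mul_pos (norm_pos_iff.2 hK) hG.norm).congr ?_
  intro n
  simp

variable [Fintype ι] [DecidableEq ι]

theorem tendsto_norm_prod_zpow_pole {P : ι → ℂ} (hP : Function.Injective P) {N : ι → ℤ} {x : ι}
    (hx : N x < 0) {c : ℂ} (hc : c ≠ 0) :
    Tendsto (fun ζ => ‖c * ∏ y, (ζ - P y) ^ N y‖) (𝓝[≠] P x) atTop := by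
  have h₁ : Tendsto (fun ζ : ℂ => c * ∏ y ∈ Finset.univ.erase x, (ζ - P y) ^ N y) (𝓝[≠] P x)
      (𝓝 (c * ∏ y ∈ Finset.univ.erase x, (P x - P y) ^ N y)) := by
    refine (tendsto_prod_zpow N (fun y _ => ?_) fun y hy => ?_).const_mul c
    · exact ((continuous_id.sub continuous_const).tendsto _).mono_left nhdsWithin_le_nhds
    · exact sub_ne_zero.2 (hP.ne (Finset.ne_of_mem_erase hy).symm)
  have h₂ : Tendsto (fun ζ : ℂ => ζ - P x) (𝓝[≠] P x) (𝓝[≠] 0) := by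
    refine tendsto_nhdsWithin_iff.2 ⟨?_, ?_⟩
    · have : Tendsto (fun ζ : ℂ => ζ - P x) (𝓝 (P x)) (𝓝 (P x - P x)) :=
        (continuous_id.sub continuous_const).tendsto _
      rw [sub_self] at this
      exact this.mono_left nhdsWithin_le_nhds
    · filter_upwards [self_mem_nhdsWithin] with ζ hζ
      exact sub_ne_zero.2 hζ
  have h₃ := (tendsto_norm_cobounded_atTop.comp
    (tendsto_zpow_nhdsNE_zero_cobounded hx)).comp h₂
  refine (h₃.atTop_mul_pos (norm_pos_iff.2 ?_) h₁.norm).congr fun ζ => ?_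
  · refine mul_ne_zero hc (Finset.prod_ne_zero_iff.2 fun y hy => zpow_ne_zero _ ?_)
    exact sub_ne_zero.2 (hP.ne (Finset.ne_of_mem_erase hy).symm)
  · rw [← Finset.mul_prod_erase Finset.univ _ (Finset.mem_univ x), Function.comp_apply,
      Function.comp_apply, ← norm_mul]
    congr 1
    ring

theorem tendsto_prod_zpow_zero {P : ι → ℂ} (hP : Function.Injective P) {N : ι → ℤ} {x : ι}
    (hx : 0 < N x) (c : ℂ) :
    Tendsto (fun ζ => c * ∏ y, (ζ - P y) ^ N y) (𝓝 (P x)) (𝓝 0) := by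
  have h : Tendsto (fun ζ => c * ∏ y, (ζ - P y) ^ N y) (𝓝 (P x))
      (𝓝 (c * ∏ y, (P x - P y) ^ N y)) := by
    refine (tendsto_finsetProd _ fun y _ => ?_).const_mul c
    refine ((continuous_id.sub continuous_const).tendsto (P x)).zpow₀ _ ?_
    by_cases hxy : x = y
    · exact Or.inr (hxy ▸ hx.le)
    · exact Or.inl (sub_ne_zero.2 (hP.ne hxy))
  have h0 : ∏ y, (P x - P y) ^ N y = 0 :=
    Finset.prod_eq_zero (Finset.mem_univ x) (by rw [sub_self, zero_zpow _ hx.ne'])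
  rwa [h0, mul_zero] at h

end ZPowProd

section Rescaling

variable {ι : Type*} [Fintype ι] {δ : ι → ℂ} {N : ι → ℤ} {L : ℂ} {F : ℕ → ℂ → ℂ} {g : ℂ → ℂ}
  {u : Filter ℕ} {s t : ℕ → ℝ} {p : ι → ℕ → ℂ}

/-- If all zeros and poles escape to infinity, the limit is constant. -/
theorem SphLocUnifConv.eq_const_of_tendsto_cobounded [u.NeBot] (h : SphLocUnifConv F g)
    (hu : u ≤ atTop) (hL : L ≠ 0) (hs : ∀ᶠ n in u, 0 < s n) (ht : ∀ᶠ n in u, 0 < t n)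
    (hF : ∀ᶠ n in u, ∀ ζ, F n ζ = (t n : ℂ) * (L * ∏ x, ((s n : ℂ) * (ζ - p x n)) ^ N x))
    (hp : ∀ x, Tendsto (p x) u (Bornology.cobounded ℂ)) : g = fun _ => g 0 := by
  refine h.eq_const_of_tendsto_div hu fun ζ => ?_
  have h₁ : Tendsto (fun n => ∏ x, (1 - ζ * (p x n)⁻¹) ^ N x) u (𝓝 1) := by
    have := tendsto_prod_zpow (s := Finset.univ) (f := u) (b := fun x n => 1 - ζ * (p x n)⁻¹)
      (c := fun _ => 1) N (fun x _ => ?_) (fun _ _ => one_ne_zero)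
    · simpa using this
    · simpa using ((tendsto_inv₀_cobounded.comp (hp x)).const_mul ζ).const_sub 1
  refine h₁.congr' ?_
  have hp0 : ∀ᶠ n in u, ∀ x, p x n ≠ 0 :=
    eventually_all.2 fun x => (hp x).eventually (Bornology.eventually_ne_cobounded 0)
  filter_upwards [hs, ht, hF, hp0] with n hsn htn hFn hpn
  have hs' : (s n : ℂ) ≠ 0 := by exact_mod_cast hsn.ne'
  have ht' : (t n : ℂ) ≠ 0 := by exact_mod_cast htn.ne'
  rw [hFn, hFn, mul_div_mul_left _ _ ht', mul_div_mul_left _ _ hL, ← Finset.prod_div_distrib]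
  refine Finset.prod_congr rfl fun x _ => ?_
  rw [← div_zpow]
  congr 1
  have := hpn x
  field_simp
  ring

/-- If one zero or pole has a finite limit, the scale `s` cannot have a positive limit. -/
theorem SphLocUnifConv.not_tendsto_pos [u.NeBot] (h : SphLocUnifConv F g)
    (hu : u ≤ atTop) (hL : L ≠ 0) (hN : ∀ x, N x ≠ 0) (ht : Tendsto t u atTop)
    (hF : ∀ᶠ n in u, ∀ ζ, F n ζ = (t n : ℂ) * (L * ∏ x, ((s n : ℂ) * (ζ - p x n)) ^ N x))
    (hδ : ∀ᶠ n in u, ∀ x y, (s n : ℂ) * (p x n - p y n) = δ x - δ y)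
    {x₀ : ι} {w : ℂ} (hw : Tendsto (p x₀) u (𝓝 w)) {s₀ : ℝ} (hs₀ : 0 < s₀)
    (hs : Tendsto s u (𝓝 s₀)) : False := by
  have hzero : ∀ᶠ n in u, F n (p x₀ n) = 0 := by
    filter_upwards [hF] with n hn
    rw [hn, Finset.prod_eq_zero (Finset.mem_univ x₀) (by simp [zero_zpow _ (hN x₀)])]
    simp
  refine h.not_frequently_tendsto_atTop hu hw hzero ?_
  have hs' : (s₀ : ℂ) ≠ 0 := by exact_mod_cast hs₀.ne'
  have hev : ∀ᶠ ζ in 𝓝[≠] w, ∀ x, (s₀ : ℂ) * (ζ - w) + (δ x₀ - δ x) ≠ 0 := by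
    refine eventually_all.2 fun x => ?_
    have : ∀ᶠ ζ in 𝓝[≠] w, ζ ≠ w + (δ x - δ x₀) / s₀ := by
      by_cases hx : w + (δ x - δ x₀) / s₀ = w
      · rw [hx]
        exact self_mem_nhdsWithin
      · exact eventually_ne_nhdsWithin (Ne.symm hx)
    filter_upwards [this] with ζ hζ h0
    apply hζ
    field_simp
    linear_combination h0
  refine (hev.frequently.filter_mono nhdsWithin_le_nhds).mono fun ζ hζ => ?_
  have hlim : Tendsto (fun n => L * ∏ x, ((s n : ℂ) * (ζ - p x₀ n) + (δ x₀ - δ x)) ^ N x) u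
      (𝓝 (L * ∏ x, ((s₀ : ℂ) * (ζ - w) + (δ x₀ - δ x)) ^ N x)) := by
    refine (tendsto_prod_zpow N (fun x _ => ?_) fun x _ => hζ x).const_mul L
    exact (((continuous_ofReal.tendsto _).comp hs).mul (hw.const_sub ζ)).add_const _
  refine (tendsto_norm_mul_atTop ht hlim (mul_ne_zero hL (Finset.prod_ne_zero_iff.2
    fun x _ => zpow_ne_zero _ (hζ x)))).congr' ?_
  filter_upwards [hF, hδ] with n hn hδn
  rw [hn]
  congr 3
  refine Finset.prod_congr rfl fun x _ => ?_
  congr 1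
  linear_combination -(hδn x₀ x)

/-- If one zero or pole has a finite limit and there is a genuine zero, the scale `s` cannot
tend to `∞`. -/
theorem SphLocUnifConv.not_tendsto_atTop (u : Ultrafilter ℕ) (h : SphLocUnifConv F g)
    (hu : (u : Filter ℕ) ≤ atTop) (hδinj : Function.Injective δ) (hL : L ≠ 0) (hN : ∀ x, N x ≠ 0)
    (hpos : ∃ x, 0 < N x) (ht : Tendsto t u atTop)
    (hF : ∀ᶠ n in (u : Filter ℕ), ∀ ζ,
      F n ζ = (t n : ℂ) * (L * ∏ x, ((s n : ℂ) * (ζ - p x n)) ^ N x))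
    (hδ : ∀ᶠ n in (u : Filter ℕ), ∀ x y, (s n : ℂ) * (p x n - p y n) = δ x - δ y)
    {x₀ : ι} {w : ℂ} (hw : Tendsto (p x₀) u (𝓝 w)) (hs : Tendsto s u atTop) : False := by
  classical
  have hzero : ∀ᶠ n in (u : Filter ℕ), F n (p x₀ n) = 0 := by
    filter_upwards [hF] with n hn
    rw [hn, Finset.prod_eq_zero (Finset.mem_univ x₀) (by simp [zero_zpow _ (hN x₀)])]
    simp
  have hs1 : ∀ᶠ n in (u : Filter ℕ), 1 ≤ s n := hs.eventually_ge_atTop 1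
  have ht1 : ∀ᶠ n in (u : Filter ℕ), 1 ≤ t n := ht.eventually_ge_atTop 1
  have hw' : ∀ x, Tendsto (p x) u (𝓝 w) := by
    intro x
    have h₁ : Tendsto (fun n => p x₀ n + (δ x - δ x₀) * ((s n)⁻¹ : ℝ)) u
        (𝓝 (w + (δ x - δ x₀) * (0 : ℝ))) :=
      hw.add (((continuous_ofReal.tendsto _).comp (tendsto_inv_atTop_zero.comp hs)).const_mul _)
    simp only [ofReal_zero, mul_zero, add_zero] at h₁
    refine h₁.congr' ?_
    filter_upwards [hδ, hs1] with n hn hsn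
    have hs' : (s n : ℂ) ≠ 0 := by exact_mod_cast (by linarith : s n ≠ 0)
    rw [← hn x x₀]
    push_cast
    field_simp
    ring
  have hPinj : ∀ᶠ n in (u : Filter ℕ), Function.Injective fun x => p x n := by
    filter_upwards [hδ] with n hn x y hxy
    have := hn x y
    simp only at hxy
    rw [hxy, sub_self, mul_zero] at this
    exact hδinj (sub_eq_zero.1 this.symm)
  set d : ℤ := ∑ x, N x with hd
  set c : ℕ → ℝ := fun n => t n * s n ^ d with hc
  have hF' : ∀ᶠ n in (u : Filter ℕ), ∀ ζ, F n ζ = (c n : ℂ) * (L * ∏ x, (ζ - p x n) ^ N x) := by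
    filter_upwards [hF, hs1] with n hn hsn ζ
    have hs' : (s n : ℂ) ≠ 0 := by exact_mod_cast (by linarith : s n ≠ 0)
    have hsd : ∏ x, (s n : ℂ) ^ N x = (s n : ℂ) ^ d :=
      prod_zpow_eq_zpow_sum Finset.univ N hs'
    rw [hn]
    simp only [mul_zpow, Finset.prod_mul_distrib, hsd, hc]
    push_cast
    ring
  have hlim : ∀ ζ, ζ ≠ w → Tendsto (fun n => L * ∏ x, (ζ - p x n) ^ N x) u
      (𝓝 (L * ∏ x, (ζ - w) ^ N x)) := fun ζ hζ =>
    (tendsto_prod_zpow N (fun x _ => (hw' x).const_sub ζ)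
      fun x _ => sub_ne_zero.2 hζ).const_mul L
  have hlim0 : ∀ ζ, ζ ≠ w → L * ∏ x, (ζ - w) ^ N x ≠ 0 := fun ζ hζ =>
    mul_ne_zero hL (Finset.prod_ne_zero_iff.2 fun x _ => zpow_ne_zero _ (sub_ne_zero.2 hζ))
  have hcpos : ∀ᶠ n in (u : Filter ℕ), 0 < c n := by
    filter_upwards [hs1, ht1] with n hsn htn
    have : 0 < s n := by linarith
    have : 0 < t n := by linarith
    positivity
  rcases u.tendsto_atTop_or_exists_tendsto_nhds (hcpos.mono fun n hn => hn.le) with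
    hcT | ⟨v, hv0, hcv⟩
  · refine h.not_frequently_tendsto_atTop hu hw hzero ?_
    have hev : ∀ᶠ ζ in 𝓝[≠] w, ζ ≠ w := self_mem_nhdsWithin
    refine (hev.frequently.filter_mono nhdsWithin_le_nhds).mono fun ζ hζ => ?_
    refine (tendsto_norm_mul_atTop hcT (hlim ζ hζ) (hlim0 ζ hζ)).congr' ?_
    filter_upwards [hF'] with n hn
    rw [hn]
  have hd0 : d < 0 := by
    by_contra! hd0
    refine not_tendsto_nhds_of_tendsto_atTop (tendsto_atTop_mono' _ ?_ ht) v hcv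
    filter_upwards [hs1, ht1] with n hsn htn
    exact le_mul_of_one_le_right (by linarith) (one_le_zpow₀ hsn hd0)
  have hg : ∀ ζ, ζ ≠ w → g ζ = v * (L * ∏ x, (ζ - w) ^ N x) := by
    intro ζ hζ
    refine h.eq_of_tendsto_s4 hu ((((continuous_ofReal.tendsto _).comp hcv).mul
      (hlim ζ hζ)).congr' ?_)
    filter_upwards [hF'] with n hn
    rw [hn, Function.comp_apply]
  obtain ⟨U, hU, hUg⟩ := h.exists_tendstoUniformlyOn hu hw hzero
  have hclose := Metric.tendstoUniformlyOn_iff.1 hUg 1 one_pos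
  have hne : ∀ y : ℂ, ∀ᶠ ζ in 𝓝[≠] y, ζ ≠ w := by
    intro y
    by_cases hy : y = w
    · rw [hy]
      exact self_mem_nhdsWithin
    · exact eventually_ne_nhdsWithin hy
  rcases hv0.eq_or_lt with hv | hv
  · obtain ⟨x₁, -, hx₁⟩ : ∃ x ∈ Finset.univ, N x < 0 := by
      by_contra! hcon
      exact absurd (Finset.sum_nonneg hcon) (not_le.2 hd0)
    have hmem : ∀ᶠ n in (u : Filter ℕ), U ∈ 𝓝 (p x₁ n) :=
      (hw' x₁).eventually (eventually_mem_nhds_iff.2 hU)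
    obtain ⟨n, hn₁, hn₂, hn₃, hn₄, hn₅⟩ :=
      (hclose.and (hmem.and (hF'.and (hPinj.and hcpos)))).exists
    have hpole := tendsto_norm_prod_zpow_pole hn₄ hx₁
      (mul_ne_zero (ofReal_ne_zero.2 hn₅.ne') hL)
    obtain ⟨ζ, hζ₁, hζ₂, hζ₃⟩ := ((hpole.eventually_ge_atTop 1).and
      ((hne (p x₁ n)).and (mem_nhdsWithin_of_mem_nhds hn₂))).exists
    have := hn₁ ζ hζ₃
    rw [hg ζ hζ₂, ← hv, ofReal_zero, zero_mul, dist_zero_left, hn₃, ← mul_assoc] at this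
    linarith
  · obtain ⟨x₂, hx₂⟩ := hpos
    have hgT : Tendsto (fun ζ => ‖g ζ‖) (𝓝[≠] w) atTop := by
      have := tendsto_norm_prod_zpow_pole (ι := Unit) (P := fun _ => w)
        (N := fun _ => d) (x := ()) (fun _ _ _ => rfl) hd0
        (mul_ne_zero (ofReal_ne_zero.2 hv.ne') hL)
      refine this.congr' ?_
      filter_upwards [self_mem_nhdsWithin] with ζ hζ
      rw [hg ζ hζ, prod_zpow_eq_zpow_sum Finset.univ N (sub_ne_zero.2 hζ)]
      simp [mul_assoc, hd]
    have hV : {ζ | ζ ∈ U ∧ (ζ ≠ w → 2 ≤ ‖g ζ‖)} ∈ 𝓝 w :=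
      inter_mem hU (eventually_nhdsWithin_iff.1 (hgT.eventually_ge_atTop 2))
    have hmem := (hw' x₂).eventually (eventually_mem_nhds_iff.2 hV)
    obtain ⟨n, hn₁, hn₂, hn₃, hn₄⟩ := (hclose.and (hmem.and (hF'.and hPinj))).exists
    have hzero₂ := (tendsto_prod_zpow_zero hn₄ hx₂ ((c n : ℂ) * L)).norm.mono_left
      (nhdsWithin_le_nhds (s := {p x₂ n}ᶜ))
    rw [norm_zero] at hzero₂
    obtain ⟨ζ, hζ₁, hζ₂, hζ₃⟩ := ((hzero₂.eventually_lt_const one_pos).and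
      ((hne (p x₂ n)).and (mem_nhdsWithin_of_mem_nhds hn₂))).exists
    have h₁ := hn₁ ζ hζ₃.1
    have h₂ := hζ₃.2 hζ₂
    rw [mul_assoc, ← hn₃] at hζ₁
    have h₃ : ‖g ζ‖ ≤ dist (g ζ) (F n ζ) + ‖F n ζ‖ := by
      rw [dist_eq_norm]
      exact norm_le_norm_sub_add _ _
    linarith

/-- If a zero or pole has a finite limit and the scale `s` tends to `0`, then that point is a
zero and the limit is a power of an affine map, unless it is constant. -/
theorem SphLocUnifConv.exists_eq_of_tendsto_zero [DecidableEq ι] (u : Ultrafilter ℕ)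
    (h : SphLocUnifConv F g)
    (hu : (u : Filter ℕ) ≤ atTop) (hδinj : Function.Injective δ) (hL : L ≠ 0) (hN : ∀ x, N x ≠ 0)
    (ht : Tendsto t u atTop) (hs0 : ∀ᶠ n in (u : Filter ℕ), 0 < s n)
    (hF : ∀ᶠ n in (u : Filter ℕ), ∀ ζ,
      F n ζ = (t n : ℂ) * (L * ∏ x, ((s n : ℂ) * (ζ - p x n)) ^ N x))
    (hδ : ∀ᶠ n in (u : Filter ℕ), ∀ x y, (s n : ℂ) * (p x n - p y n) = δ x - δ y)
    {x₀ : ι} {w : ℂ} (hw : Tendsto (p x₀) u (𝓝 w)) (hs : Tendsto s u (𝓝 0))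
    (hg : ∀ c : ℂ, g ≠ fun _ => c) :
    0 < N x₀ ∧ ∃ c : ℝ, 0 < c ∧ g = fun ζ =>
      (L * ∏ x ∈ Finset.univ.erase x₀, (δ x₀ - δ x) ^ N x) * (c * (ζ - w) ^ N x₀) := by
  have hzero : ∀ᶠ n in (u : Filter ℕ), F n (p x₀ n) = 0 := by
    filter_upwards [hF] with n hn
    rw [hn, Finset.prod_eq_zero (Finset.mem_univ x₀) (by simp [zero_zpow _ (hN x₀)])]
    simp
  set K := L * ∏ x ∈ Finset.univ.erase x₀, (δ x₀ - δ x) ^ N x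
  have hne : ∀ x ∈ Finset.univ.erase x₀, δ x₀ - δ x ≠ 0 := fun x hx =>
    sub_ne_zero.2 (hδinj.ne (Finset.ne_of_mem_erase hx).symm)
  have hK0 : K ≠ 0 :=
    mul_ne_zero hL (Finset.prod_ne_zero_iff.2 fun x hx => zpow_ne_zero _ (hne x hx))
  set c : ℕ → ℝ := fun n => t n * s n ^ N x₀ with hc
  set G : ℕ → ℂ → ℂ := fun n ζ => L * ∏ x ∈ Finset.univ.erase x₀,
    ((s n : ℂ) * (ζ - p x₀ n) + (δ x₀ - δ x)) ^ N x with hGdef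
  have hG : ∀ ζ, Tendsto (fun n => G n ζ) u (𝓝 K) := by
    intro ζ
    refine (tendsto_prod_zpow N (fun x _ => ?_) hne).const_mul L
    have := (((continuous_ofReal.tendsto _).comp hs).mul (hw.const_sub ζ)).add_const (δ x₀ - δ x)
    simpa using this
  have hF' : ∀ᶠ n in (u : Filter ℕ), ∀ ζ,
      F n ζ = (c n : ℂ) * (G n ζ * (ζ - p x₀ n) ^ N x₀) := by
    filter_upwards [hF, hδ] with n hn hδn ζ
    have hprod : ∏ x ∈ Finset.univ.erase x₀, ((s n : ℂ) * (ζ - p x n)) ^ N x =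
        ∏ x ∈ Finset.univ.erase x₀, ((s n : ℂ) * (ζ - p x₀ n) + (δ x₀ - δ x)) ^ N x := by
      refine Finset.prod_congr rfl fun x _ => ?_
      congr 1
      linear_combination hδn x₀ x
    rw [hn, ← Finset.mul_prod_erase Finset.univ _ (Finset.mem_univ x₀), hprod, mul_zpow]
    simp only [hc, hGdef]
    push_cast
    ring
  have hcnot : ¬ Tendsto c u atTop := by
    intro hcT
    refine h.not_frequently_tendsto_atTop hu hw hzero ?_
    have hev : ∀ᶠ ζ in 𝓝[≠] w, ζ ≠ w := self_mem_nhdsWithin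
    refine (hev.frequently.filter_mono nhdsWithin_le_nhds).mono fun ζ hζ => ?_
    have hζ' := sub_ne_zero.2 hζ
    refine (tendsto_norm_mul_atTop hcT ((hG ζ).mul ((hw.const_sub ζ).zpow₀ (N x₀)
      (Or.inl hζ'))) (mul_ne_zero hK0 (zpow_ne_zero _ hζ'))).congr' ?_
    filter_upwards [hF'] with n hn
    rw [hn]
  have hN0 : 0 < N x₀ := by
    by_contra! hneg
    refine hcnot (tendsto_atTop_mono' _ ?_ ht)
    filter_upwards [hs0, hs.eventually_le_const one_pos, ht.eventually_ge_atTop 0]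
      with n h₁ h₂ h₃
    exact le_mul_of_one_le_right h₃ (one_le_zpow_of_nonpos₀ h₁ h₂ hneg)
  refine ⟨hN0, ?_⟩
  have hcpos : ∀ᶠ n in (u : Filter ℕ), 0 ≤ c n := by
    filter_upwards [hs0, ht.eventually_ge_atTop 0] with n h₁ h₂
    positivity
  obtain ⟨v, hv0, hcv⟩ := (u.tendsto_atTop_or_exists_tendsto_nhds hcpos).resolve_left hcnot
  have hgv : g = fun ζ => K * (v * (ζ - w) ^ N x₀) := by
    funext ζ
    have h₁ := ((continuous_ofReal.tendsto _).comp hcv).mul ((hG ζ).mul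
      ((hw.const_sub ζ).zpow₀ (N x₀) (Or.inr hN0.le)))
    rw [mul_left_comm] at h₁
    refine h.eq_of_tendsto_s4 hu (h₁.congr' ?_)
    filter_upwards [hF'] with n hn
    rw [hn, Function.comp_apply]
  refine ⟨v, hv0.lt_of_ne ?_, hgv⟩
  rintro rfl
  exact hg 0 (by simp [hgv])

end Rescaling

/-- The rational function as a single product of integer powers. -/
theorem rational_eq_prod_zpow {m p : ℕ} (L z : ℂ) (γ : Fin m → ℂ) (β : Fin p → ℂ) (l : Fin m → ℕ)
    (e : Fin p → ℕ) :
    L * (∏ i, (z - γ i) ^ l i) / ∏ j, (z - β j) ^ e j =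
      L * ∏ x : Fin m ⊕ Fin p, (z - Sum.elim γ β x) ^
        (Sum.elim (fun i => (l i : ℤ)) (fun j => -(e j : ℤ)) x) := by
  simp [Fintype.prod_sum_type, div_eq_mul_inv, mul_assoc]

theorem rational_erase_eq_prod_zpow {m p : ℕ} (L z : ℂ) (γ : Fin m → ℂ) (β : Fin p → ℂ)
    (l : Fin m → ℕ) (e : Fin p → ℕ) (i : Fin m) :
    L * (∏ j ∈ Finset.univ.erase i, (z - γ j) ^ l j) / ∏ j, (z - β j) ^ e j =
      L * ∏ x ∈ (Finset.univ : Finset (Fin m ⊕ Fin p)).erase (Sum.inl i),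
        (z - Sum.elim γ β x) ^ (Sum.elim (fun i => (l i : ℤ)) (fun j => -(e j : ℤ)) x) := by
  have : (Finset.univ : Finset (Fin m ⊕ Fin p)).erase (Sum.inl i) =
      (Finset.univ.erase i).disjSum Finset.univ := by
    ext x
    rcases x with x | x <;> simp
  rw [this, Finset.prod_disjSum]
  simp [div_eq_mul_inv, mul_assoc]

theorem tendsto_rpow_neg_of_tendsto_zero {κ : Type*} {f : Filter κ} {ρ : κ → ℝ} {α : ℝ} (hα : 0 < α)
    (hρ : ∀ n, 0 < ρ n) (hρ0 : Tendsto ρ f (𝓝 0)) : Tendsto (fun n => ρ n ^ (-α)) f atTop :=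
  (tendsto_rpow_neg_nhdsGT_zero (neg_lt_zero.2 hα)).comp
    (tendsto_nhdsWithin_iff.2 ⟨hρ0, Eventually.of_forall hρ⟩)

/-- Every element of `Π_α` of a product of integer powers with a genuine zero is a multiple of a
power of an affine map. -/
theorem exists_eq_of_mem_piAlpha {ι : Type*} [Fintype ι] [DecidableEq ι] {δ : ι → ℂ} {N : ι → ℤ}
    {L : ℂ} (hδ : Function.Injective δ) (hN : ∀ x, N x ≠ 0) (hL : L ≠ 0) (hpos : ∃ x, 0 < N x)
    {α : ℝ} (hα : 0 < α) {g : ℂ → ℂ} (hg : g ∈ PiAlpha α fun z => L * ∏ x, (z - δ x) ^ N x) :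
    ∃ x₀, 0 < N x₀ ∧ ∃ (c : ℝ) (w : ℂ), 0 < c ∧ g = fun ζ =>
      (L * ∏ x ∈ Finset.univ.erase x₀, (δ x₀ - δ x) ^ N x) * (c * (ζ - w) ^ N x₀) := by
  obtain ⟨-, hconst, z₀, k, z, ρ, hk, -, hρ, hρ0, hconv⟩ := hg
  set u : Ultrafilter ℕ := hyperfilter ℕ
  have hu : (u : Filter ℕ) ≤ atTop := Nat.hyperfilter_le_atTop
  set s : ℕ → ℝ := fun n => k n * ρ n with hs
  set p : ι → ℕ → ℂ := fun x n => (δ x - k n * z n) / s n with hp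
  have ht := (tendsto_rpow_neg_of_tendsto_zero hα hρ hρ0).mono_left hu
  have hspos : ∀ᶠ n in (u : Filter ℕ), 0 < s n := by
    filter_upwards [(hk.mono_left hu).eventually_gt_atTop 0] with n hn
    exact mul_pos (Nat.cast_pos.2 hn) (hρ n)
  have hδp : ∀ᶠ n in (u : Filter ℕ), ∀ x y, (s n : ℂ) * (p x n - p y n) = δ x - δ y := by
    filter_upwards [hspos] with n hn x y
    have : (s n : ℂ) ≠ 0 := ofReal_ne_zero.2 hn.ne'
    simp only [hp]
    field_simp
    ring
  have hF : ∀ᶠ n in (u : Filter ℕ), ∀ ζ, ((ρ n ^ (-α) : ℝ) : ℂ) *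
      (L * ∏ x, ((k n : ℂ) * z n + (k n : ℂ) * (ρ n : ℂ) * ζ - δ x) ^ N x) =
      ((ρ n ^ (-α) : ℝ) : ℂ) * (L * ∏ x, ((s n : ℂ) * (ζ - p x n)) ^ N x) := by
    filter_upwards [hspos] with n hn ζ
    congr 2
    refine Finset.prod_congr rfl fun x _ => ?_
    congr 1
    have h₁ : (s n : ℂ) * p x n = δ x - k n * z n :=
      mul_div_cancel₀ _ (ofReal_ne_zero.2 hn.ne')
    have h₂ : (s n : ℂ) = k n * ρ n := by simp [hs]
    linear_combination h₁ - ζ * h₂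
  by_cases hall : ∀ x, Tendsto (p x) u (Bornology.cobounded ℂ)
  · exact absurd (hconv.eq_const_of_tendsto_cobounded hu hL hspos (ht.eventually_gt_atTop 0) hF
      hall) (hconst _)
  push Not at hall
  obtain ⟨x₀, hx₀⟩ := hall
  obtain ⟨w, hw⟩ := (u.tendsto_cobounded_or_exists_tendsto_nhds (p x₀)).resolve_left hx₀
  rcases u.tendsto_atTop_or_exists_tendsto_nhds (hspos.mono fun n hn => hn.le) with
    hsT | ⟨s₀, hs₀, hsT⟩
  · exact (hconv.not_tendsto_atTop u hu hδ hL hN hpos ht hF hδp hw hsT).elim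
  rcases hs₀.eq_or_lt with rfl | hs₀
  · obtain ⟨hx, c, hc, hgc⟩ :=
      hconv.exists_eq_of_tendsto_zero u hu hδ hL hN ht hspos hF hδp hw hsT hconst
    exact ⟨x₀, hx, c, w, hc, hgc⟩
  · exact (hconv.not_tendsto_pos hu hL hN ht hF hδp hw hs₀ hsT).elim

/-- Every multiple `S γ * (A ζ + C) ^ l` arises as a rescaling limit at a zero `γ` of order `l` of
`(z - γ) ^ l * S z`. -/
theorem mem_piAlpha_of_zero {S : ℂ → ℂ} {γ : ℂ} {l : ℕ} (hl : 1 ≤ l) (hS : ContinuousAt S γ)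
    (hS0 : S γ ≠ 0) {α : ℝ} (hα₁ : 0 < α) (hα₂ : α < 1) {A : ℝ} (hA : 0 < A) (C : ℂ) :
    (fun ζ => S γ * ((A : ℂ) * ζ + C) ^ l) ∈ PiAlpha α fun z => (z - γ) ^ l * S z := by
  have hA' : (A : ℂ) ≠ 0 := ofReal_ne_zero.2 hA.ne'
  have hl0 : (0 : ℝ) < l := by exact_mod_cast hl
  have hαl : α / l < 1 := by
    rw [div_lt_one hl0]
    exact hα₂.trans_le (by exact_mod_cast hl)
  have hb : 0 < 1 - α / l := by linarith
  refine ⟨?_, ?_, ?_⟩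
  · intro z _
    have : Differentiable ℂ fun ζ : ℂ => S γ * ((A : ℂ) * ζ + C) ^ l := by fun_prop
    exact (this.analyticAt z).meromorphicAt
  · intro c hc
    have h₁ := congrFun hc (-C / A)
    have h₂ := congrFun hc ((1 - C) / A)
    simp only [mul_div_cancel₀ _ hA', neg_add_cancel, sub_add_cancel, one_pow, mul_one] at h₁ h₂
    rw [zero_pow (by omega), mul_zero] at h₁
    exact hS0 (h₂.trans h₁.symm)
  set ρ : ℕ → ℝ := fun n => (A / (n + 1 : ℕ)) ^ (1 - α / l)⁻¹ with hρ
  have hpos : ∀ n, 0 < ρ n := fun n => by positivity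
  have hquot : Tendsto (fun n : ℕ => A / ((n + 1 : ℕ) : ℝ)) atTop (𝓝 0) :=
    tendsto_const_nhds.div_atTop
      (tendsto_natCast_atTop_atTop.comp (tendsto_add_atTop_nat 1))
  have hρ0 : Tendsto ρ atTop (𝓝 0) := by
    have := hquot.rpow_const (p := (1 - α / l)⁻¹) (Or.inr (by positivity))
    rwa [Real.zero_rpow (by positivity)] at this
  have hkρ : ∀ n, ((n + 1 : ℕ) : ℝ) * ρ n = A * ρ n ^ (α / l) := by
    intro n
    have h₁ : ρ n ^ (1 - α / l) = A / (n + 1 : ℕ) :=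
      Real.rpow_inv_rpow (by positivity) hb.ne'
    rw [Real.rpow_sub (hpos n), Real.rpow_one] at h₁
    have := Real.rpow_pos_of_pos (hpos n) (α / l)
    field_simp at h₁
    linarith
  have hs0 : Tendsto (fun n : ℕ => ((n + 1 : ℕ) : ℝ) * ρ n) atTop (𝓝 0) := by
    simp only [hkρ]
    have := (hρ0.rpow_const (p := α / l) (Or.inr (by positivity))).const_mul A
    rwa [Real.zero_rpow (by positivity), mul_zero] at this
  have hsc : ∀ n, ρ n ^ (-α) * (((n + 1 : ℕ) : ℝ) * ρ n) ^ l = A ^ l := by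
    intro n
    rw [hkρ, mul_pow, ← Real.rpow_natCast (ρ n ^ (α / l)), ← Real.rpow_mul (hpos n).le,
      div_mul_cancel₀ _ hl0.ne', mul_left_comm, ← Real.rpow_add (hpos n)]
    simp
  refine ⟨0, fun n => n + 1, fun n => γ / (n + 1 : ℕ) + ρ n * (C / A), ρ,
    tendsto_add_atTop_nat 1, ?_, hpos, hρ0, ?_⟩
  · have h₁ : Tendsto (fun n : ℕ => γ / ((n + 1 : ℕ) : ℂ)) atTop (𝓝 0) :=
      (tendsto_const_div_atTop_nhds_zero_nat γ).comp (tendsto_add_atTop_nat 1)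
    have h₂ := ((continuous_ofReal.tendsto _).comp hρ0).mul_const (C / A)
    simpa using h₁.add h₂
  have hF : ∀ (n : ℕ) (ζ : ℂ), ((ρ n ^ (-α) : ℝ) : ℂ) *
      ((((n + 1 : ℕ) : ℂ) * (γ / (n + 1 : ℕ) + ρ n * (C / A)) + ((n + 1 : ℕ) : ℂ) * ρ n * ζ - γ) ^ l
        * S (((n + 1 : ℕ) : ℂ) * (γ / (n + 1 : ℕ) + ρ n * (C / A)) + ((n + 1 : ℕ) : ℂ) * ρ n * ζ)) =
      S (γ + ((((n + 1 : ℕ) : ℝ) * ρ n : ℝ) : ℂ) * (ζ + C / A)) * ((A : ℂ) * ζ + C) ^ l := by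
    intro n ζ
    have hn : ((n + 1 : ℕ) : ℂ) ≠ 0 := Nat.cast_ne_zero.2 n.succ_ne_zero
    have harg : ((n + 1 : ℕ) : ℂ) * (γ / (n + 1 : ℕ) + ρ n * (C / A)) +
        ((n + 1 : ℕ) : ℂ) * ρ n * ζ =
        γ + ((((n + 1 : ℕ) : ℝ) * ρ n : ℝ) : ℂ) * (ζ + C / A) := by
      rw [mul_add, mul_div_cancel₀ _ hn, ofReal_mul, ofReal_natCast]
      ring
    have hsc' : ((ρ n ^ (-α) : ℝ) : ℂ) * ((((n + 1 : ℕ) : ℝ) * ρ n : ℝ) : ℂ) ^ l = (A : ℂ) ^ l := by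
      exact_mod_cast congrArg ofReal (hsc n)
    have haff : (A : ℂ) * ζ + C = A * (ζ + C / A) := by
      field_simp
    rw [harg, add_sub_cancel_left, haff, mul_pow, mul_pow, ← hsc']
    ring
  have hloc : TendstoLocallyUniformly (fun (n : ℕ) (ζ : ℂ) =>
      S (γ + ((((n + 1 : ℕ) : ℝ) * ρ n : ℝ) : ℂ) * (ζ + C / A)) * ((A : ℂ) * ζ + C) ^ l)
      (fun ζ => S γ * ((A : ℂ) * ζ + C) ^ l) atTop := by
    rw [tendstoLocallyUniformly_iff_forall_tendsto]
    intro ζ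
    have h₁ : Tendsto (fun y : ℕ × ℂ => y.2) (atTop ×ˢ 𝓝 ζ) (𝓝 ζ) := tendsto_snd
    have h₂ : Tendsto (fun y : ℕ × ℂ => ((A : ℂ) * y.2 + C) ^ l) (atTop ×ˢ 𝓝 ζ)
        (𝓝 (((A : ℂ) * ζ + C) ^ l)) := ((h₁.const_mul _).add_const _).pow l
    have h₃ : Tendsto (fun y : ℕ × ℂ =>
        γ + ((((y.1 + 1 : ℕ) : ℝ) * ρ y.1 : ℝ) : ℂ) * (y.2 + C / A)) (atTop ×ˢ 𝓝 ζ) (𝓝 γ) := by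
      have := ((((continuous_ofReal.tendsto _).comp hs0).comp
        (tendsto_fst (f := atTop) (g := 𝓝 ζ))).mul (h₁.add_const (C / (A : ℂ)))).const_add γ
      simpa using this
    exact ((h₂.const_mul (S γ)).prodMk_nhds ((hS.tendsto.comp h₃).mul h₂)).mono_right
      (nhds_le_uniformity _)
  intro ζ
  refine ⟨Metric.closedBall ζ 1, Metric.closedBall_mem_nhds ζ one_pos, Or.inl ?_⟩
  simp only [hF]
  exact tendstoLocallyUniformly_iff_forall_isCompact.1 hloc _ (isCompact_closedBall ζ 1)

/-- For a nonconstant rational function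
`R(z) = L·∏ (z - γ i)^(l i) / ∏ (z - β j)^(e j)` (zeros `γ i` with multiplicities `l i`,
poles `β j` with multiplicities `e j`, all distinct, at least one zero), with
`R̃_{γ i}(γ i) = L·∏_{j ≠ i}(γ i - γ j)^(l j) / ∏_j (γ i - β j)^(e j)`, for every
`0 < α < 1`, `Π_α(R) = { ζ ↦ R̃_{γ i}(γ i)·(Aζ + C)^(l i) : i, A > 0 real, C ∈ ℂ }`. -/
theorem piAlpha_rational_pos (m p : ℕ) (hm : 1 ≤ m) (L : ℂ) (hL : L ≠ 0)
    (γ : Fin m → ℂ) (β : Fin p → ℂ) (hγ : Function.Injective γ)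
    (hβ : Function.Injective β) (hγβ : ∀ i j, γ i ≠ β j)
    (l : Fin m → ℕ) (hl : ∀ i, 1 ≤ l i) (e : Fin p → ℕ) (he : ∀ j, 1 ≤ e j)
    (α : ℝ) (hα₁ : 0 < α) (hα₂ : α < 1) :
    PiAlpha α (fun z => L * (∏ i, (z - γ i) ^ l i) / ∏ j, (z - β j) ^ e j) =
      { g | ∃ (i : Fin m) (A : ℝ) (C : ℂ), 0 < A ∧
          g = fun ζ =>
            (L * (∏ j ∈ Finset.univ.erase i, (γ i - γ j) ^ l j) /
                ∏ j, (γ i - β j) ^ e j) * ((A : ℂ) * ζ + C) ^ l i } := by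
  have hδ : Function.Injective (Sum.elim γ β) := hγ.sumElim hβ hγβ
  have hN : ∀ x, Sum.elim (fun i => (l i : ℤ)) (fun j => -(e j : ℤ)) x ≠ 0 := by
    rintro (i | j)
    · have := hl i
      simp only [Sum.elim_inl]
      omega
    · have := he j
      simp only [Sum.elim_inr]
      omega
  ext g
  constructor
  · intro hg
    simp only [rational_eq_prod_zpow] at hg
    obtain ⟨i | j, hx, c, w, hc, rfl⟩ := exists_eq_of_mem_piAlpha hδ hN hL
      ⟨Sum.inl ⟨0, hm⟩, by simpa using Nat.one_le_iff_ne_zero.1 (hl ⟨0, hm⟩)|>.bot_lt⟩ hα₁ hg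
    · have hli : l i ≠ 0 := Nat.one_le_iff_ne_zero.1 (hl i)
      refine ⟨i, c ^ (l i : ℝ)⁻¹, -((c ^ (l i : ℝ)⁻¹ : ℝ) : ℂ) * w, by positivity, ?_⟩
      funext ζ
      rw [rational_erase_eq_prod_zpow, neg_mul, ← sub_eq_add_neg, ← mul_sub, mul_pow,
        ← ofReal_pow, Real.rpow_inv_natCast_pow hc.le hli]
      simp
    · simp only [Sum.elim_inr] at hx
      omega
  · rintro ⟨i, A, C, hA, rfl⟩
    have hS : ContinuousAt (fun z => L * (∏ j ∈ Finset.univ.erase i, (z - γ j) ^ l j) /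
        ∏ j, (z - β j) ^ e j) (γ i) := by
      refine ContinuousAt.div (by fun_prop) (by fun_prop) ?_
      exact Finset.prod_ne_zero_iff.2 fun j _ => pow_ne_zero _ (sub_ne_zero.2 (hγβ i j))
    have hS0 : L * (∏ j ∈ Finset.univ.erase i, (γ i - γ j) ^ l j) /
        ∏ j, (γ i - β j) ^ e j ≠ 0 := by
      refine div_ne_zero (mul_ne_zero hL ?_) ?_
      · exact Finset.prod_ne_zero_iff.2 fun j hj => pow_ne_zero _
          (sub_ne_zero.2 (hγ.ne (Finset.ne_of_mem_erase hj).symm))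
      · exact Finset.prod_ne_zero_iff.2 fun j _ => pow_ne_zero _ (sub_ne_zero.2 (hγβ i j))
    have hmem := mem_piAlpha_of_zero (hl i) hS hS0 hα₁ hα₂ hA C
    convert hmem using 2
    funext z
    rw [← Finset.mul_prod_erase Finset.univ _ (Finset.mem_univ i)]
    ring
end
end

section
/- Let f be a nonconstant meromorphic function on ℂ and let α be a real number with −1 < α < 1. If a nonconstant meromorphic function g belongs to Π_α(f), then for every C ∈ ℂ the function ζ ↦ g(ζ + C) also belongs to Π_α(f). -/
open Filter Topology Complex

noncomputable section

theorem SphLocUnifConv.comp_add_right {F : ℕ → ℂ → ℂ} {g : ℂ → ℂ} (h : SphLocUnifConv F g)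
    (C : ℂ) : SphLocUnifConv (fun n ζ => F n (ζ + C)) (fun ζ => g (ζ + C)) := by
  intro z₀
  obtain ⟨U, hU, hconv⟩ := h (z₀ + C)
  refine ⟨(· + C) ⁻¹' U, (continuous_add_const C).continuousAt.preimage_mem_nhds hU, ?_⟩
  rcases hconv with hconv | ⟨hne, hconv⟩
  · exact Or.inl (hconv.comp (· + C))
  · exact Or.inr ⟨hne.mono fun n hn w hw => hn _ hw, hconv.comp (· + C)⟩

/-- (Lemma 3.1(1)) For a nonconstant meromorphic `f` on `ℂ` and
`-1 < α < 1`, if `g ∈ Π_α(f)` then for every `C ∈ ℂ`, `ζ ↦ g(ζ + C) ∈ Π_α(f)`. -/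
theorem piAlpha_translate (f : ℂ → ℂ) (hf : MeromorphicOn f Set.univ)
    (hfnc : ∀ c : ℂ, f ≠ fun _ => c)
    (α : ℝ) (hα₁ : -1 < α) (hα₂ : α < 1)
    (g : ℂ → ℂ) (hg : g ∈ PiAlpha α f) (C : ℂ) :
    (fun ζ => g (ζ + C)) ∈ PiAlpha α f := by
  obtain ⟨hmero, hnc, z₀, k, z, ρ, hk, hz, hρpos, hρ, hconv⟩ := hg
  refine ⟨fun x _ => ?_, fun c hc => hnc c ?_, z₀, k, fun n => z n + ρ n * C, ρ, hk, ?_,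
    hρpos, hρ, ?_⟩
  · exact MeromorphicAt.comp_analyticAt (g := (· + C)) (hmero (x + C) (Set.mem_univ _)) (by fun_prop)
  · funext w
    simpa using congrFun hc (w - C)
  · have hρC : Tendsto (fun n => (ρ n : ℂ)) atTop (𝓝 0) := by
      simpa [Function.comp_def] using (continuous_ofReal.tendsto 0).comp hρ
    simpa using hz.add (hρC.mul_const C)
  · convert hconv.comp_add_right C using 5
    ring
end
end

section
/- Let f be a nonconstant meromorphic function on ℂ and let α be a real number with −1 < α < 1. Suppose that for some a ∈ ℂ with a ≠ 0 and some b ∈ ℂ the function ζ ↦ e^{aζ + b} belongs to Π_α(f). Then for every a′ ∈ ℂ with a′ ≠ 0 and arg a′ = arg a, and for every b′ ∈ ℂ, the function ζ ↦ e^{a′ζ + b′} also belongs to Π_α(f). -/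
open Filter Topology Complex

noncomputable section

/-- Spherical locally uniform convergence is stable under precomposition with a continuous map
and multiplication by a nonzero constant. -/
theorem SphLocUnifConv.const_mul_comp {F : ℕ → ℂ → ℂ} {g : ℂ → ℂ} (h : SphLocUnifConv F g)
    {s : ℂ} (hs : s ≠ 0) {φ : ℂ → ℂ} (hφ : Continuous φ) :
    SphLocUnifConv (fun n ζ => s * F n (φ ζ)) (fun ζ => s * g (φ ζ)) := by
  intro z₀
  obtain ⟨U, hU, hconv⟩ := h (φ z₀)
  refine ⟨φ ⁻¹' U, hφ.continuousAt hU, ?_⟩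
  rcases hconv with hconv | ⟨hne, hconv⟩
  · exact Or.inl ((uniformContinuous_const_smul s).comp_tendstoUniformlyOn (hconv.comp φ))
  · refine Or.inr ⟨hne.mono fun n hn w hw => mul_ne_zero hs (hn _ hw), ?_⟩
    simp only [mul_inv]
    exact (uniformContinuous_const_smul s⁻¹).comp_tendstoUniformlyOn (hconv.comp φ)

theorem exp_affine_ne_const {a : ℂ} (ha : a ≠ 0) (b c : ℂ) :
    (fun ζ => Complex.exp (a * ζ + b)) ≠ fun _ => c := by
  intro h
  have h₀ : Complex.exp (a * 0 + b) = c := congrFun h 0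
  have h₁ : Complex.exp (a * a⁻¹ + b) = c := congrFun h a⁻¹
  have h₂ := congrArg norm (h₁.trans h₀.symm)
  simp [ha, Complex.norm_exp] at h₂

/-- `Π_α(h)` is stable under `g ↦ t^{-α} g(c + t ζ)` for `t > 0`, up to nonconstancy and
meromorphy of the new function. -/
theorem PiAlpha.rescale {α : ℝ} {h g : ℂ → ℂ} (hg : g ∈ PiAlpha α h) {t : ℝ} (ht : 0 < t) (c : ℂ)
    (hmero : MeromorphicOn (fun ζ => ((t ^ (-α) : ℝ) : ℂ) * g (c + t * ζ)) Set.univ)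
    (hnc : ∀ d : ℂ, (fun ζ => ((t ^ (-α) : ℝ) : ℂ) * g (c + t * ζ)) ≠ fun _ => d) :
    (fun ζ => ((t ^ (-α) : ℝ) : ℂ) * g (c + t * ζ)) ∈ PiAlpha α h := by
  obtain ⟨-, -, z₀, k, z, ρ, hk, hz, hρ, hρ₀, hconv⟩ := hg
  refine ⟨hmero, hnc, z₀, k, fun n => z n + ρ n * c, fun n => t * ρ n, hk, ?_,
    fun n => mul_pos ht (hρ n), by simpa using hρ₀.const_mul t, ?_⟩
  · have hρc : Tendsto (fun n => (ρ n : ℂ)) atTop (𝓝 0) := by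
      simpa [Function.comp_def] using (Complex.continuous_ofReal.tendsto 0).comp hρ₀
    simpa using hz.add (hρc.mul_const c)
  · have hs : ((t ^ (-α) : ℝ) : ℂ) ≠ 0 := by
      exact_mod_cast (Real.rpow_pos_of_pos ht (-α)).ne'
    have hφ : Continuous fun ζ : ℂ => c + t * ζ := by fun_prop
    convert hconv.const_mul_comp hs hφ using 3 with n ζ
    rw [Real.mul_rpow ht.le (hρ n).le]
    push_cast
    rw [mul_assoc]
    congr 3
    ring

/-- (Lemma 3.1(2)) For a nonconstant meromorphic `f` on `ℂ` and
`-1 < α < 1`: if `ζ ↦ e^{aζ + b} ∈ Π_α(f)` for some `a ≠ 0`, `b ∈ ℂ`, then for every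
`a' ≠ 0` with `arg a' = arg a` (i.e. `a' = t·a` with `t > 0` real) and every `b' ∈ ℂ`,
`ζ ↦ e^{a'ζ + b'} ∈ Π_α(f)`. -/
theorem piAlpha_exp_arg (f : ℂ → ℂ) (hf : MeromorphicOn f Set.univ)
    (hfnc : ∀ c : ℂ, f ≠ fun _ => c)
    (α : ℝ) (hα₁ : -1 < α) (hα₂ : α < 1)
    (a b : ℂ) (ha : a ≠ 0)
    (hab : (fun ζ => Complex.exp (a * ζ + b)) ∈ PiAlpha α f)
    (a' : ℂ) (ha' : a' ≠ 0) (harg : ∃ t : ℝ, 0 < t ∧ a' = (t : ℂ) * a) (b' : ℂ) :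
    (fun ζ => Complex.exp (a' * ζ + b')) ∈ PiAlpha α f := by
  obtain ⟨t, ht, rfl⟩ := harg
  have hfun : (fun ζ => Complex.exp (t * a * ζ + b')) = fun ζ => ((t ^ (-α) : ℝ) : ℂ) *
      Complex.exp (a * ((b' - b + α * Real.log t) / a + t * ζ) + b) := by
    funext ζ
    rw [Real.rpow_def_of_pos ht, Complex.ofReal_exp, ← Complex.exp_add]
    congr 1
    push_cast
    field_simp
    ring
  have hnc := exp_affine_ne_const ha' b'
  have hmero : MeromorphicOn (fun ζ => Complex.exp (t * a * ζ + b')) Set.univ := by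
    intro ζ _
    have : AnalyticAt ℂ (fun ζ => Complex.exp (t * a * ζ + b')) ζ := by fun_prop
    exact this.meromorphicAt
  rw [hfun] at hnc hmero ⊢
  exact PiAlpha.rescale hab ht _ hmero hnc
end
end

section
/- Let f(z) = R(z)·e^{P(z)} where R is a nonzero rational function and P is a polynomial of degree k ≥ 1 with leading coefficient a_k ≠ 0. Let arg a_k ∈ [0, 2π), and for l = 0,…,k−1 set θ_k^{±}(l) = (±π/2 − arg a_k)/k + 2πl/k, and let R_θ = { r·e^{iθ} : r ≥ 0 }. If z₀ ∈ ℂ does not lie on any of the 2k rays R_{θ_k^{+}(l)}, R_{θ_k^{−}(l)} (l = 0,…,k−1), then there exists r > 0 such that, as n → ∞ through the natural numbers, either (i) for all sufficiently large n the point nz is not a pole of R for every z in the disk Δ(z₀,r) = { |z − z₀| < r } and f(nz) → 0 uniformly on Δ(z₀,r), or (ii) |f(nz)| → ∞ uniformly on Δ(z₀,r). -/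
open Filter Topology Complex

noncomputable section

open Bornology Asymptotics in
/-- On the region where the leading term of `P` has real part at most `-c * ‖w‖ ^ deg P`, the
function `(P₁ / P₂) * exp P` tends to `0` at infinity. -/
theorem tendsto_rational_mul_exp_zero (P₁ P₂ P : Polynomial ℂ) (hP₂ : P₂ ≠ 0)
    (hP : 1 ≤ P.natDegree) {c : ℝ} (hc : 0 < c) :
    Tendsto (fun w => P₁.eval w / P₂.eval w * Complex.exp (P.eval w))
      (cobounded ℂ ⊓
        𝓟 {w | (P.leadingCoeff * w ^ P.natDegree).re ≤ -c * ‖w‖ ^ P.natDegree}) (𝓝 0) := by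
  set k := P.natDegree with hk
  set a := P.leadingCoeff with ha
  have ha0 : 0 < ‖a‖ := by
    rw [norm_pos_iff, ha, Polynomial.leadingCoeff_ne_zero]
    rintro rfl
    simp at hk
    omega
  have hR : (fun w => P₁.eval w / P₂.eval w) =O[cobounded ℂ]
      fun w => ‖w‖ ^ P₁.natDegree := by
    have hnum : P₁.eval =O[cobounded ℂ] fun w => ‖w‖ ^ P₁.natDegree := by
      have := Polynomial.isBigO_cobounded_of_degree_le (P := P₁)
        (Q := (Polynomial.X : Polynomial ℂ) ^ P₁.natDegree)
        (by simp)
      simpa using this.norm_right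
    have hden : (fun w => (P₂.eval w)⁻¹) =O[cobounded ℂ] fun _ => (1 : ℝ) := by
      have h := Polynomial.isBigO_cobounded_of_degree_le (P := (1 : Polynomial ℂ)) (Q := P₂)
        (by simpa using Polynomial.zero_le_degree_iff.2 hP₂)
      have h' := h.inv_rev (by simp)
      simpa using h'.trans (isBigO_of_le (g := fun _ => (1 : ℝ)) _ (by simp))
    simpa [div_eq_mul_inv] using hnum.mul hden
  have hexp : (fun w => Complex.exp (P.eval w)) =O[cobounded ℂ ⊓
      𝓟 {w | (a * w ^ k).re ≤ -c * ‖w‖ ^ k}] fun w => Real.exp (-(c / 2) * ‖w‖) := by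
    have hlead := (Polynomial.isEquivalent_cobounded_leading_monomial (P := P)).isLittleO.def
      (show 0 < c / (2 * ‖a‖) by positivity)
    have hone : ∀ᶠ w : ℂ in cobounded ℂ, 1 ≤ ‖w‖ :=
      tendsto_norm_cobounded_atTop.eventually_ge_atTop 1
    refine IsBigO.of_bound 1 ?_
    rw [eventually_inf_principal]
    filter_upwards [hlead, hone] with w hw h1 hS
    have hS' : (a * w ^ k).re ≤ -c * ‖w‖ ^ k := hS
    simp only [Pi.sub_apply, norm_mul, norm_pow] at hw
    rw [← ha, ← hk] at hw
    have hre := (Complex.re_le_norm _).trans hw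
    rw [Complex.sub_re] at hre
    have hca : c / (2 * ‖a‖) * (‖a‖ * ‖w‖ ^ k) = c / 2 * ‖w‖ ^ k := by
      field_simp
    rw [hca] at hre
    have hpow : ‖w‖ ≤ ‖w‖ ^ k := le_self_pow₀ h1 (by omega)
    rw [Complex.norm_exp, Real.norm_eq_abs, Real.abs_exp, one_mul, Real.exp_le_exp]
    nlinarith
  have hdecay : Tendsto (fun w : ℂ => ‖w‖ ^ P₁.natDegree * Real.exp (-(c / 2) * ‖w‖))
      (cobounded ℂ) (𝓝 0) := by
    have h := (isLittleO_pow_exp_pos_mul_atTop (k := P₁.natDegree)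
      (half_pos hc)).tendsto_div_nhds_zero.comp (tendsto_norm_cobounded_atTop (E := ℂ))
    refine h.congr fun w => ?_
    simp [div_eq_mul_inv, ← Real.exp_neg]
  exact ((hR.mono inf_le_left).mul hexp).trans_tendsto (hdecay.mono_left inf_le_left)

open Bornology in
/-- If `a * z₀ ^ k` has negative real part, then dilating a small disk about `z₀` by `n` goes to
infinity uniformly, inside a region where `(a * w ^ k).re ≤ -c * ‖w‖ ^ k`. -/
theorem exists_ball_tendsto_natCast_mul (a z₀ : ℂ) {k : ℕ} (hz₀ : z₀ ≠ 0)
    (h : (a * z₀ ^ k).re < 0) :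
    ∃ r > 0, ∃ c > 0, Tendsto (fun p : ℕ × ℂ => (p.1 : ℂ) * p.2)
      (atTop ×ˢ 𝓟 (Metric.ball z₀ r))
      (cobounded ℂ ⊓ 𝓟 {w | (a * w ^ k).re ≤ -c * ‖w‖ ^ k}) := by
  have hn : 0 < ‖z₀‖ := norm_pos_iff.2 hz₀
  set c := -(a * z₀ ^ k).re / (2 * ‖z₀‖ ^ k) with hc
  have hc0 : 0 < c := div_pos (neg_pos.2 h) (by positivity)
  have hcont : Continuous fun z : ℂ => (a * z ^ k).re + c * ‖z‖ ^ k := by fun_prop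
  have hlt : (a * z₀ ^ k).re + c * ‖z₀‖ ^ k < 0 := by
    have : c * ‖z₀‖ ^ k = -(a * z₀ ^ k).re / 2 := by
      rw [hc]
      field_simp
    linarith
  have hsector := hcont.continuousAt.eventually_lt_const hlt
  have hnorm := continuous_norm.continuousAt.eventually_const_lt (half_lt_self hn)
  obtain ⟨r, hr, hball⟩ := Metric.eventually_nhds_iff_ball.1 (hsector.and hnorm)
  refine ⟨r, hr, c, hc0, tendsto_inf.2 ⟨?_, ?_⟩⟩
  · rw [← tendsto_norm_atTop_iff_cobounded]
    have hfst : Tendsto (fun p : ℕ × ℂ => (p.1 : ℝ) * (‖z₀‖ / 2))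
        (atTop ×ˢ 𝓟 (Metric.ball z₀ r)) atTop :=
      (tendsto_natCast_atTop_atTop.comp tendsto_fst).atTop_mul_const (half_pos hn)
    refine tendsto_atTop_mono' _ ?_ hfst
    filter_upwards [tendsto_snd.eventually (mem_principal_self _)] with p hp
    rw [norm_mul, Complex.norm_natCast]
    have := (hball _ hp).2.le
    gcongr
  · rw [tendsto_principal]
    filter_upwards [tendsto_snd.eventually (mem_principal_self _)] with p hp
    have h1 := (hball _ hp).1
    have h2 : (a * ((p.1 : ℂ) * p.2) ^ k).re = (p.1 : ℝ) ^ k * (a * p.2 ^ k).re := by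
      rw [← Complex.re_ofReal_mul]
      push_cast
      ring_nf
    have h3 : (0 : ℝ) ≤ (p.1 : ℝ) ^ k := by positivity
    change (a * ((p.1 : ℂ) * p.2) ^ k).re ≤ -c * ‖(p.1 : ℂ) * p.2‖ ^ k
    rw [h2, norm_mul, Complex.norm_natCast, mul_pow]
    nlinarith

/-- If `a * z ^ k` is purely imaginary, then `z` lies on one of the `2k` rays
`arg z = (±π/2 - arg a) / k + 2πl/k`. -/
theorem exists_ray_of_re_mul_pow_eq_zero {a z : ℂ} {k : ℕ} (hk : 1 ≤ k) (ha : a ≠ 0)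
    {θ : ℝ} (hθ : a = (‖a‖ : ℂ) * Complex.exp (θ * Complex.I)) (h : (a * z ^ k).re = 0) :
    ∃ l : ℕ, l < k ∧ ∃ s : ℝ, (s = 1 ∨ s = -1) ∧ ∃ r : ℝ, 0 ≤ r ∧
      z = (r : ℂ) * Complex.exp (((s * (Real.pi / 2) - θ) / k + 2 * Real.pi * l / k : ℝ)
        * Complex.I) := by
  have hkR : (k : ℝ) ≠ 0 := by positivity
  rcases eq_or_ne z 0 with rfl | hz
  · exact ⟨0, hk, 1, Or.inl rfl, 0, le_rfl, by simp⟩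
  have hpolar : a * z ^ k = ((‖a‖ * ‖z‖ ^ k : ℝ) : ℂ) *
      Complex.exp ((θ + k * z.arg : ℝ) * Complex.I) := by
    conv_lhs => rw [hθ, ← Complex.norm_mul_exp_arg_mul_I z]
    rw [mul_pow, ← Complex.exp_nat_mul]
    push_cast
    rw [add_mul, Complex.exp_add]
    ring_nf
  have hcos : Real.cos (θ + k * z.arg) = 0 := by
    rw [hpolar, Complex.re_ofReal_mul, Complex.exp_ofReal_mul_I_re] at h
    have : ‖a‖ * ‖z‖ ^ k ≠ 0 := by positivity
    exact (mul_eq_zero.1 h).resolve_left this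
  obtain ⟨m, hm⟩ := Real.cos_eq_zero_iff.1 hcos
  obtain ⟨s, hs, j, hj⟩ : ∃ s : ℝ, (s = 1 ∨ s = -1) ∧ ∃ j : ℤ,
      θ + k * z.arg = s * (Real.pi / 2) + 2 * Real.pi * j := by
    rcases Int.even_or_odd' m with ⟨j, rfl | rfl⟩
    · refine ⟨1, Or.inl rfl, j, ?_⟩
      rw [hm]
      push_cast
      ring
    · refine ⟨-1, Or.inr rfl, j + 1, ?_⟩
      rw [hm]
      push_cast
      ring
  have hkZ : (0 : ℤ) < k := by exact_mod_cast hk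
  obtain ⟨l, hl⟩ := Int.eq_ofNat_of_zero_le (Int.emod_nonneg j hkZ.ne')
  have hlk : l < k := by
    have := Int.emod_lt_of_pos j hkZ
    omega
  refine ⟨l, hlk, s, hs, ‖z‖, norm_nonneg z, ?_⟩
  have hjl : (j : ℝ) = l + k * (j / (k : ℤ) : ℤ) := by
    have := Int.emod_add_mul_ediv j k
    rw [hl] at this
    exact_mod_cast this.symm
  have harg : z.arg = (s * (Real.pi / 2) - θ) / k + 2 * Real.pi * l / k +
      (j / (k : ℤ) : ℤ) * (2 * Real.pi) := by
    rw [hjl] at hj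
    field_simp
    linarith
  conv_lhs => rw [← Complex.norm_mul_exp_arg_mul_I z, harg]
  congr 1
  rw [Complex.exp_eq_exp_iff_exists_int]
  refine ⟨j / (k : ℤ), ?_⟩
  push_cast
  ring

/-- (Lemma 3.2, normality part) Let `f = R·e^P` with `R = P₁/P₂` a
nonzero rational function and `P` a polynomial of degree `k ≥ 1` with leading coefficient
`a_k`, `arg a_k = θa ∈ [0, 2π)`. If `z₀` lies on none of the `2k` rays
`R_{(±π/2 − θa)/k + 2πl/k}` (`l = 0, …, k−1`), then there is `r > 0` such that on the disk
`Δ(z₀, r)` either `f(nz) → 0` uniformly (with `nz` eventually never a pole), or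
`|f(nz)| → ∞` uniformly (poles counting as `∞`). -/
theorem normal_off_rays (P₁ P₂ : Polynomial ℂ) (hP₁ : P₁ ≠ 0) (hP₂ : P₂ ≠ 0)
    (hcop : IsCoprime P₁ P₂)
    (P : Polynomial ℂ) (k : ℕ) (hk : 1 ≤ k) (hdeg : P.natDegree = k)
    (ak : ℂ) (hak : P.leadingCoeff = ak)
    (θa : ℝ) (hθ₁ : 0 ≤ θa) (hθ₂ : θa < 2 * Real.pi)
    (hθ : ak = (‖ak‖ : ℂ) * Complex.exp (θa * Complex.I))
    (f : ℂ → ℂ) (hf : f = fun z => P₁.eval z / P₂.eval z * Complex.exp (P.eval z))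
    (z₀ : ℂ)
    (hz₀ : ∀ l : ℕ, l < k → ∀ s : ℝ, (s = 1 ∨ s = -1) → ∀ r : ℝ, 0 ≤ r →
      z₀ ≠ (r : ℂ) * Complex.exp (((s * (Real.pi / 2) - θa) / k + 2 * Real.pi * l / k : ℝ)
        * Complex.I)) :
    ∃ r : ℝ, 0 < r ∧
      ((∀ ε : ℝ, 0 < ε → ∀ᶠ n : ℕ in atTop, ∀ z ∈ Metric.ball z₀ r,
          P₂.eval ((n : ℂ) * z) ≠ 0 ∧ ‖f ((n : ℂ) * z)‖ < ε) ∨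
        (∀ M : ℝ, ∀ᶠ n : ℕ in atTop, ∀ z ∈ Metric.ball z₀ r,
          P₂.eval ((n : ℂ) * z) = 0 ∨ M < ‖f ((n : ℂ) * z)‖)) := by
  subst hf hak hdeg
  have hlead : P.leadingCoeff ≠ 0 := by
    rw [Polynomial.leadingCoeff_ne_zero]
    rintro rfl
    simp at hk
  have hz₀' : z₀ ≠ 0 := by
    simpa using hz₀ 0 hk 1 (Or.inl rfl) 0 le_rfl
  have hre : (P.leadingCoeff * z₀ ^ P.natDegree).re ≠ 0 := fun h => by
    obtain ⟨l, hl, s, hs, r, hr, hz⟩ := exists_ray_of_re_mul_pow_eq_zero hk hlead hθ h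
    exact hz₀ l hl s hs r hr hz
  have hne : ∀ Q : Polynomial ℂ, Q ≠ 0 → ∀ᶠ w in Bornology.cobounded ℂ, Q.eval w ≠ 0 := by
    intro Q hQ
    have hfin : {w | Q.eval w = 0}.Finite := Polynomial.finite_setOfPred_isRoot hQ
    exact Bornology.isBounded_def.1 hfin.isBounded
  have unpack : ∀ {r : ℝ} {p : ℕ → ℂ → Prop},
      (∀ᶠ x in atTop ×ˢ 𝓟 (Metric.ball z₀ r), p x.1 x.2) →
        ∀ᶠ n in atTop, ∀ z ∈ Metric.ball z₀ r, p n z := by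
    intro r p h
    simpa using eventually_prod_principal_iff.1 h
  rcases hre.lt_or_gt with hneg | hpos
  · obtain ⟨r, hr, c, hc, hT⟩ := exists_ball_tendsto_natCast_mul _ _ hz₀' hneg
    refine ⟨r, hr, Or.inl fun ε hε => unpack ?_⟩
    have h0 := (tendsto_rational_mul_exp_zero P₁ P₂ P hP₂ hk hc).norm
    rw [norm_zero] at h0
    exact hT.eventually (((hne P₂ hP₂).filter_mono inf_le_left).and
      (h0.eventually_lt_const hε))
  · obtain ⟨r, hr, c, hc, hT⟩ := exists_ball_tendsto_natCast_mul (-P).leadingCoeff z₀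
      (k := (-P).natDegree) hz₀' (by simpa using hpos)
    refine ⟨r, hr, Or.inr fun M => unpack ?_⟩
    have h0 := (tendsto_rational_mul_exp_zero P₂ P₁ (-P) hP₁ (by simpa using hk) hc).norm
    rw [norm_zero] at h0
    have hM : 0 < (|M| + 1)⁻¹ := by positivity
    refine hT.eventually (p := fun w => P₂.eval w = 0 ∨
      M < ‖P₁.eval w / P₂.eval w * Complex.exp (P.eval w)‖) ?_
    filter_upwards [(hne P₁ hP₁).filter_mono inf_le_left, h0.eventually_lt_const hM]
      with w h₁ hw
    refine or_iff_not_imp_left.2 fun h₂ => ?_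
    have hinv : P₂.eval w / P₁.eval w * Complex.exp ((-P).eval w) =
        (P₁.eval w / P₂.eval w * Complex.exp (P.eval w))⁻¹ := by
      rw [Polynomial.eval_neg, Complex.exp_neg, mul_inv, inv_div]
    have hpos' : 0 < ‖P₁.eval w / P₂.eval w * Complex.exp (P.eval w)‖ :=
      norm_pos_iff.2 (mul_ne_zero (div_ne_zero h₁ h₂) (Complex.exp_ne_zero _))
    rw [hinv, norm_inv, inv_lt_inv₀ hpos' (by positivity)] at hw
    linarith [le_abs_self M]
end
end

section
/- Let f(z) = R(z)·e^{P(z)} where R is a nonzero rational function and P is a polynomial of degree k ≥ 1 with leading coefficient a_k ≠ 0. Let arg a_k ∈ [0, 2π), and for l = 0,…,k−1 set θ_k^{±}(l) = (±π/2 − arg a_k)/k + 2πl/k, and let R_θ = { r·e^{iθ} : r ≥ 0 }. If z₀ lies on one of the 2k rays R_{θ_k^{+}(l)}, R_{θ_k^{−}(l)} (l = 0,…,k−1), then for every ε > 0 there exist points z and z′ with |z − z₀| < ε and |z′ − z₀| < ε such that f(nz) → 0 and |f(nz′)| → ∞ as n → ∞ through the natural numbers. In particular, the family { z ↦ f(nz)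 : n ∈ ℕ } is not normal at z₀, and together with the complementary statement, the set of points of non-normality of this family in ℂ is exactly the union of these 2k rays. -/
open Filter Topology Complex

noncomputable section

lemma Polynomial.tendsto_eval_natCast_mul_div_pow (Q : Polynomial ℂ) (w : ℂ) :
    Tendsto (fun n : ℕ => Q.eval ((n : ℂ) * w) / (n : ℂ) ^ Q.natDegree) atTop
      (𝓝 (Q.leadingCoeff * w ^ Q.natDegree)) := by
  have hterm : ∀ i ∈ Finset.range Q.natDegree,
      Tendsto (fun n : ℕ => Q.coeff i * w ^ i * ((n : ℂ)⁻¹) ^ (Q.natDegree - i)) atTop (𝓝 0) := by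
    intro i hi
    have hpos : Q.natDegree - i ≠ 0 := (Nat.sub_pos_of_lt (Finset.mem_range.mp hi)).ne'
    simpa [hpos] using ((tendsto_inv_atTop_nhds_zero_nat (𝕜 := ℂ)).pow
      (Q.natDegree - i)).const_mul (Q.coeff i * w ^ i)
  have hsum := (tendsto_finsetSum _ hterm).add_const (Q.leadingCoeff * w ^ Q.natDegree)
  rw [Finset.sum_const_zero, zero_add] at hsum
  refine hsum.congr' ?_
  filter_upwards [eventually_ne_atTop 0] with n hn
  have hn' : (n : ℂ) ≠ 0 := Nat.cast_ne_zero.mpr hn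
  rw [Polynomial.eval_eq_sum_range, Finset.sum_range_succ, add_div, Finset.sum_div]
  congr 1
  · refine Finset.sum_congr rfl fun i hi => ?_
    have hi' := (Finset.mem_range.mp hi).le
    rw [← Nat.sub_add_cancel hi', pow_add, Nat.add_sub_cancel, inv_pow, mul_pow]
    field_simp
  · rw [Polynomial.coeff_natDegree, mul_pow]
    field_simp

lemma Polynomial.eventually_eval_natCast_mul_ne_zero {Q : Polynomial ℂ} (hQ : Q ≠ 0) {w : ℂ}
    (hw : w ≠ 0) : ∀ᶠ n : ℕ in atTop, Q.eval ((n : ℂ) * w) ≠ 0 := by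
  have hlim : Q.leadingCoeff * w ^ Q.natDegree ≠ 0 :=
    mul_ne_zero (Polynomial.leadingCoeff_ne_zero.mpr hQ) (pow_ne_zero _ hw)
  filter_upwards [(Q.tendsto_eval_natCast_mul_div_pow w).eventually_ne hlim] with n hn h0
  simp [h0] at hn

lemma Polynomial.tendsto_pow_mul_exp_eval_natCast_mul {P : Polynomial ℂ} (hP : P.natDegree ≠ 0)
    {w : ℂ} (hw : (P.leadingCoeff * w ^ P.natDegree).re < 0) (d : ℕ) :
    Tendsto (fun n : ℕ => (n : ℂ) ^ d * Complex.exp (P.eval ((n : ℂ) * w))) atTop (𝓝 0) := by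
  obtain ⟨c, hwc, hc⟩ := exists_between hw
  have hr : |Real.exp c| < 1 := by
    rw [abs_of_pos (Real.exp_pos c)]
    exact Real.exp_lt_one_iff.mpr hc
  refine squeeze_zero_norm' ?_ (tendsto_pow_const_mul_const_pow_of_abs_lt_one d hr)
  have hre := (Complex.continuous_re.tendsto _).comp (P.tendsto_eval_natCast_mul_div_pow w)
  filter_upwards [hre.eventually_lt_const hwc, eventually_ge_atTop 1] with n hn hn1
  have hn1' : (1 : ℝ) ≤ n := by exact_mod_cast hn1
  have hpow : (n : ℝ) ≤ (n : ℝ) ^ P.natDegree := le_self_pow₀ hn1' hP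
  have hbound : (P.eval ((n : ℂ) * w)).re ≤ n * c := by
    have hcast : ((n : ℂ) ^ P.natDegree) = (((n : ℝ) ^ P.natDegree : ℝ) : ℂ) := by push_cast; rfl
    rw [Function.comp_apply, hcast, Complex.div_ofReal_re, div_lt_iff₀ (by positivity)] at hn
    nlinarith
  rw [norm_mul, norm_pow, Complex.norm_natCast, Complex.norm_exp, ← Real.exp_nat_mul]
  gcongr

lemma tendsto_rational_mul_exp_natCast_mul (P₁ : Polynomial ℂ) {P₂ P : Polynomial ℂ}
    (hP₂ : P₂ ≠ 0) (hP : P.natDegree ≠ 0) {w : ℂ}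
    (hw : (P.leadingCoeff * w ^ P.natDegree).re < 0) :
    Tendsto (fun n : ℕ => P₁.eval ((n : ℂ) * w) / P₂.eval ((n : ℂ) * w) *
      Complex.exp (P.eval ((n : ℂ) * w))) atTop (𝓝 0) := by
  have hw0 : w ≠ 0 := by
    rintro rfl
    simp [hP] at hw
  have hlim : P₂.leadingCoeff * w ^ P₂.natDegree ≠ 0 :=
    mul_ne_zero (Polynomial.leadingCoeff_ne_zero.mpr hP₂) (pow_ne_zero _ hw0)
  have hquot := (P₁.tendsto_eval_natCast_mul_div_pow w).div
    (P₂.tendsto_eval_natCast_mul_div_pow w) hlim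
  have hinv : Tendsto (fun n : ℕ => ((n : ℂ)⁻¹) ^ P₂.natDegree) atTop
      (𝓝 (0 ^ P₂.natDegree)) := (tendsto_inv_atTop_nhds_zero_nat (𝕜 := ℂ)).pow _
  have hprod := (hquot.mul hinv).mul
    (Polynomial.tendsto_pow_mul_exp_eval_natCast_mul hP hw P₁.natDegree)
  rw [mul_zero] at hprod
  refine hprod.congr' ?_
  filter_upwards [eventually_ne_atTop 0,
    Polynomial.eventually_eval_natCast_mul_ne_zero hP₂ hw0] with n hn hn₂
  have hn' : (n : ℂ) ≠ 0 := Nat.cast_ne_zero.mpr hn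
  simp only [Pi.div_apply, inv_pow]
  field_simp

lemma tendsto_norm_rational_mul_exp_natCast_mul_atTop {P₁ P₂ P : Polynomial ℂ}
    (hP₁ : P₁ ≠ 0) (hP₂ : P₂ ≠ 0) (hP : P.natDegree ≠ 0) {w : ℂ}
    (hw : 0 < (P.leadingCoeff * w ^ P.natDegree).re) :
    Tendsto (fun n : ℕ => ‖P₁.eval ((n : ℂ) * w) / P₂.eval ((n : ℂ) * w) *
      Complex.exp (P.eval ((n : ℂ) * w))‖) atTop atTop := by
  have hw0 : w ≠ 0 := by
    rintro rfl
    simp [hP] at hw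
  have hrecip := tendsto_rational_mul_exp_natCast_mul P₂ (P := -P) (w := w) hP₁
    (by rwa [Polynomial.natDegree_neg])
    (by rw [Polynomial.natDegree_neg, Polynomial.leadingCoeff_neg, neg_mul, Complex.neg_re]
        exact neg_lt_zero.mpr hw)
  have hne : ∀ᶠ n : ℕ in atTop, P₂.eval ((n : ℂ) * w) / P₁.eval ((n : ℂ) * w) *
      Complex.exp ((-P).eval ((n : ℂ) * w)) ≠ 0 := by
    filter_upwards [Polynomial.eventually_eval_natCast_mul_ne_zero hP₁ hw0,
      Polynomial.eventually_eval_natCast_mul_ne_zero hP₂ hw0] with n h₁ h₂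
    exact mul_ne_zero (div_ne_zero h₂ h₁) (Complex.exp_ne_zero _)
  have hinv := tendsto_norm_inv_nhdsNE_zero_atTop.comp
    (tendsto_nhdsWithin_iff.mpr ⟨hrecip, hne⟩)
  refine hinv.congr fun n => ?_
  simp [Complex.exp_neg, inv_div, mul_comm]

lemma isOpenMap_const_mul_pow {a : ℂ} (ha : a ≠ 0) {k : ℕ} (hk : k ≠ 0) :
    IsOpenMap fun z : ℂ => a * z ^ k := by
  have han : AnalyticOnNhd ℂ (fun z : ℂ => a * z ^ k) Set.univ := fun z _ => by fun_prop
  rcases han.is_constant_or_isOpen isPreconnected_univ with ⟨c, hc⟩ | h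
  · have h0 := hc 0 trivial
    have h1 := hc 1 trivial
    simp only [zero_pow hk, mul_zero, one_pow, mul_one] at h0 h1
    exact absurd (h1.trans h0.symm) ha
  · exact fun s hs => h s (Set.subset_univ s) hs

lemma exists_norm_sub_lt_re_neg_and_pos {g : ℂ → ℂ} (hg : IsOpenMap g) {z₀ : ℂ}
    (hre : (g z₀).re = 0) {ε : ℝ} (hε : 0 < ε) :
    (∃ z, ‖z - z₀‖ < ε ∧ (g z).re < 0) ∧ ∃ z, ‖z - z₀‖ < ε ∧ 0 < (g z).re := by
  have hopen := Complex.isOpenMap_re.comp hg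
  have hnhds := hopen.image_mem_nhds (Metric.ball_mem_nhds z₀ hε)
  rw [Function.comp_apply, hre] at hnhds
  obtain ⟨δ, hδ, hball⟩ := Metric.mem_nhds_iff.mp hnhds
  obtain ⟨z, hz, hzre⟩ := hball (show -(δ / 2) ∈ Metric.ball (0 : ℝ) δ by
    rw [mem_ball_zero_iff, Real.norm_eq_abs, abs_neg, abs_of_pos (half_pos hδ)]
    exact half_lt_self hδ)
  obtain ⟨z', hz', hzre'⟩ := hball (show δ / 2 ∈ Metric.ball (0 : ℝ) δ by
    rw [mem_ball_zero_iff, Real.norm_eq_abs, abs_of_pos (half_pos hδ)]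
    exact half_lt_self hδ)
  rw [Function.comp_apply] at hzre hzre'
  exact ⟨⟨z, mem_ball_iff_norm.mp hz, by linarith⟩, z', mem_ball_iff_norm.mp hz', by linarith⟩

/-- On the critical rays the leading term of the exponent is purely imaginary. -/
lemma re_mul_pow_eq_zero_of_mem_ray {a : ℂ} {θ : ℝ} (ha : a = (‖a‖ : ℂ) * Complex.exp (θ * I))
    {k : ℕ} (hk : k ≠ 0) (l : ℕ) {s : ℝ} (hs : s = 1 ∨ s = -1) (r : ℝ) :
    (a * ((r : ℂ) * Complex.exp (((s * (Real.pi / 2) - θ) / k + 2 * Real.pi * l / k : ℝ)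
      * I)) ^ k).re = 0 := by
  have hk' : (k : ℂ) ≠ 0 := Nat.cast_ne_zero.mpr hk
  have harg : (θ : ℂ) * I + k * ((((s * (Real.pi / 2) - θ) / k + 2 * Real.pi * l / k : ℝ) : ℂ) * I)
      = ((s * (Real.pi / 2) : ℝ) : ℂ) * I + l * (2 * Real.pi * I) := by
    push_cast
    field_simp
    ring
  have hprod : a * ((r : ℂ) * Complex.exp (((s * (Real.pi / 2) - θ) / k + 2 * Real.pi * l / k : ℝ)
      * I)) ^ k = ((‖a‖ * r ^ k : ℝ) : ℂ) * Complex.exp (((s * (Real.pi / 2) : ℝ) : ℂ) * I) := by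
    rw [← Complex.exp_periodic.nat_mul l (((s * (Real.pi / 2) : ℝ) : ℂ) * I), ← harg,
      Complex.exp_add, Complex.exp_nat_mul, mul_pow]
    nth_rewrite 1 [ha]
    push_cast
    ring
  rw [hprod, Complex.re_ofReal_mul, Complex.exp_ofReal_mul_I_re]
  rcases hs with rfl | rfl <;> simp

/-- (Lemma 3.2, non-normality part) Let `f = R·e^P` with `R = P₁/P₂` a
nonzero rational function and `P` a polynomial of degree `k ≥ 1` with leading coefficient
`a_k`, `arg a_k = θa ∈ [0, 2π)`. If `z₀` lies on one of the `2k` rays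
`R_{(±π/2 − θa)/k + 2πl/k}` (`l = 0, …, k−1`), then every disk `{|w − z₀| < ε}` contains
points `z`, `z'` with `f(nz) → 0` and `|f(nz')| → ∞` as `n → ∞` (poles counting as `∞`). -/
theorem not_normal_on_rays (P₁ P₂ : Polynomial ℂ) (hP₁ : P₁ ≠ 0) (hP₂ : P₂ ≠ 0)
    (hcop : IsCoprime P₁ P₂)
    (P : Polynomial ℂ) (k : ℕ) (hk : 1 ≤ k) (hdeg : P.natDegree = k)
    (ak : ℂ) (hak : P.leadingCoeff = ak)
    (θa : ℝ) (hθ₁ : 0 ≤ θa) (hθ₂ : θa < 2 * Real.pi)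
    (hθ : ak = (‖ak‖ : ℂ) * Complex.exp (θa * Complex.I))
    (f : ℂ → ℂ) (hf : f = fun z => P₁.eval z / P₂.eval z * Complex.exp (P.eval z))
    (z₀ : ℂ)
    (hz₀ : ∃ l : ℕ, l < k ∧ ∃ s : ℝ, (s = 1 ∨ s = -1) ∧ ∃ r : ℝ, 0 ≤ r ∧
      z₀ = (r : ℂ) * Complex.exp (((s * (Real.pi / 2) - θa) / k + 2 * Real.pi * l / k : ℝ)
        * Complex.I)) :
    ∀ ε : ℝ, 0 < ε →
      ∃ z z' : ℂ, ‖z - z₀‖ < ε ∧ ‖z' - z₀‖ < ε ∧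
        (∀ᶠ n : ℕ in atTop, P₂.eval ((n : ℂ) * z) ≠ 0) ∧
        Tendsto (fun n : ℕ => ‖f ((n : ℂ) * z)‖) atTop (𝓝 0) ∧
        (∀ M : ℝ, ∀ᶠ n : ℕ in atTop,
          P₂.eval ((n : ℂ) * z') = 0 ∨ M < ‖f ((n : ℂ) * z')‖) := by
  subst hf hdeg hak
  intro ε hε
  have hk0 : P.natDegree ≠ 0 := Nat.one_le_iff_ne_zero.mp hk
  have hlead : P.leadingCoeff ≠ 0 := by
    rw [Polynomial.leadingCoeff_ne_zero]
    rintro rfl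
    exact hk0 Polynomial.natDegree_zero
  obtain ⟨l, -, s, hs, r, -, rfl⟩ := hz₀
  obtain ⟨⟨z, hz, hzre⟩, z', hz', hzre'⟩ := exists_norm_sub_lt_re_neg_and_pos
    (isOpenMap_const_mul_pow hlead hk0) (re_mul_pow_eq_zero_of_mem_ray hθ hk0 l hs r) hε
  have hz0 : z ≠ 0 := by
    rintro rfl
    simp [hk0] at hzre
  refine ⟨z, z', hz, hz', Polynomial.eventually_eval_natCast_mul_ne_zero hP₂ hz0, ?_,
    fun M => ?_⟩
  · exact tendsto_zero_iff_norm_tendsto_zero.mp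
      (tendsto_rational_mul_exp_natCast_mul P₁ hP₂ hk0 hzre)
  · exact ((tendsto_norm_rational_mul_exp_natCast_mul_atTop hP₁ hP₂ hk0 hzre').eventually_gt_atTop
      M).mono fun _ => Or.inr
end
end
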